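/- arXiv:2112.15134 — 3 statements merged into one kernel-verified Lean document; each statement's English description precedes it below -/
import Mathlib

section
/- Let P ⊂ ℝ² be a convex lattice polygon of nonzero area A(P), and let l = ls_Δ(P). Then A(P) ≥ l/2. Equivalently, every lattice polygon P of nonzero area has a lattice-equivalent copy contained in the dilate 2A(P)·Δ of the standard simplex. -/
open Set MeasureTheory Pointwise

/-- A plane convex body: a compact convex subset of ℝ² with nonempty interior. -/
def IsPlaneConvexBody (P : Set (Fin 2 → ℝ)) : Prop :=
  IsCompact P ∧ Convex ℝ P ∧ (interior P).Nonempty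

/-- The width of `P` in the direction `u`. -/
noncomputable def width (P : Set (Fin 2 → ℝ)) (u : Fin 2 → ℝ) : ℝ :=
  sSup ((fun p => u 0 * p 0 + u 1 * p 1) '' P) -
    sInf ((fun p => u 0 * p 0 + u 1 * p 1) '' P)

/-- An affine unimodular transformation: multiplication by an integer matrix with
determinant `±1` followed by a translation by an integer vector. -/
def IsUnimodularMap (φ : (Fin 2 → ℝ) → (Fin 2 → ℝ)) : Prop :=
  ∃ (A : Matrix (Fin 2) (Fin 2) ℤ) (t : Fin 2 → ℤ),
    (A.det = 1 ∨ A.det = -1) ∧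
    ∀ x, φ x = (A.map (Int.cast : ℤ → ℝ)).mulVec x + fun i => (t i : ℝ)

/-- Two subsets of ℝ² are lattice-equivalent if one is the image of the other
under an affine unimodular transformation. -/
def LatticeEquivalent (P Q : Set (Fin 2 → ℝ)) : Prop :=
  ∃ φ, IsUnimodularMap φ ∧ Q = φ '' P

/-- The `l`-dilate of the unit square, `[0,l]²`. -/
def squareDilate (l : ℝ) : Set (Fin 2 → ℝ) :=
  {x | ∀ i, x i ∈ Set.Icc 0 l}

/-- The `l`-dilate of the standard 2-simplex. -/
def simplexDilate (l : ℝ) : Set (Fin 2 → ℝ) :=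
  {x | 0 ≤ x 0 ∧ 0 ≤ x 1 ∧ x 0 + x 1 ≤ l}

/-- The lattice size of `P` with respect to the unit square. -/
noncomputable def lsSquare (P : Set (Fin 2 → ℝ)) : ℝ :=
  sInf {l : ℝ | 0 ≤ l ∧ ∃ φ, IsUnimodularMap φ ∧ φ '' P ⊆ squareDilate l}

/-- The lattice size of `P` with respect to the standard simplex. -/
noncomputable def lsDelta (P : Set (Fin 2 → ℝ)) : ℝ :=
  sInf {l : ℝ | 0 ≤ l ∧ ∃ φ, IsUnimodularMap φ ∧ φ '' P ⊆ simplexDilate l}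

/-- The lattice width of `P`: the minimum of `width P u` over primitive integer
directions `u`. -/
noncomputable def latticeWidth (P : Set (Fin 2 → ℝ)) : ℝ :=
  sInf {w : ℝ | ∃ u : Fin 2 → ℤ, Int.gcd (u 0) (u 1) = 1 ∧
    w = width P (fun i => (u i : ℝ))}

/-- A lattice polygon: the convex hull of a (nonempty) finite set of points of ℤ². -/
def IsLatticePolygon (P : Set (Fin 2 → ℝ)) : Prop :=
  ∃ S : Finset (Fin 2 → ℤ), S.Nonempty ∧
    P = convexHull ℝ ((fun p : Fin 2 → ℤ => fun i => (p i : ℝ)) '' (S : Set (Fin 2 → ℤ)))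

/-- The area of a plane set: its two-dimensional Lebesgue measure. -/
noncomputable def area (P : Set (Fin 2 → ℝ)) : ℝ :=
  (volume P).toReal


/-- Normalised integer core, width at least two. -/
lemma core_ge_two (S : Set (ℤ × ℤ)) (hS : S.Finite) (D w : ℤ) (hw : 2 ≤ w)
    (hD : ∀ p ∈ S, ∀ q ∈ S, ∀ r ∈ S, ∀ s ∈ S,
      (q.1 - p.1) * (s.2 - r.2) - (q.2 - p.2) * (s.1 - r.1) ≤ D)
    (hy : ∀ p ∈ S, 0 ≤ p.2 ∧ p.2 ≤ w)
    (hb : ∃ p ∈ S, p.2 = 0) (ht : ∃ p ∈ S, p.2 = w)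
    (hmin : ∀ j k : ℤ, ¬ ∀ p ∈ S, k ≤ p.1 - j * p.2 ∧ p.1 - j * p.2 ≤ k + w - 1) :
    ∃ a b c d e f : ℤ, (a * d - b * c = 1 ∨ a * d - b * c = -1) ∧ ∀ p ∈ S,
      0 ≤ a * p.1 + b * p.2 + e ∧ 0 ≤ c * p.1 + d * p.2 + f ∧
      (a * p.1 + b * p.2 + e) + (c * p.1 + d * p.2 + f) ≤ D := by
  obtain ⟨p, hpS, hp⟩ := hb
  obtain ⟨q, hqS, hq⟩ := ht
  obtain ⟨r0, hr0, hr0min⟩ := Set.exists_min_image S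
    (fun r => w * r.1 - (q.1 - p.1) * r.2) hS ⟨p, hpS⟩
  obtain ⟨j, c, hc0, hcw, hC⟩ : ∃ j c : ℤ, 0 ≤ c ∧ c < w ∧ q.1 - p.1 = j * w + c :=
    ⟨(q.1 - p.1) / w, (q.1 - p.1) % w, Int.emod_nonneg _ (by omega),
      Int.emod_lt_of_pos _ (by omega), by rw [mul_comm]; exact (Int.mul_ediv_add_emod _ _).symm⟩
  set m0 := w * r0.1 - (q.1 - p.1) * r0.2 with hm0
  have hlow : ∀ r ∈ S, m0 ≤ w * (r.1 - j * r.2) - c * r.2 := by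
    intro r hr
    have h := hr0min r hr
    simp only [hC] at h
    linarith
  have hup : ∀ r ∈ S, w * (r.1 - j * r.2) - c * r.2 ≤ m0 + D := by
    intro r hr
    have h := hD p hpS q hqS r hr r0 hr0
    rw [hC, hp, hq] at h
    rw [hm0, hC]; linarith
  -- the lower integer bound
  obtain ⟨k, hk1, hk2⟩ : ∃ k : ℤ, m0 ≤ w * k ∧ w * (k - 1) < m0 :=
    ⟨-((-m0) / w), by nlinarith [Int.mul_ediv_self_le (x := -m0) (k := w) (by omega)],
      by nlinarith [Int.lt_mul_ediv_self_add (x := -m0) (k := w) (by omega)]⟩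
  have hxk : ∀ r ∈ S, k ≤ r.1 - j * r.2 := by
    intro r hr
    have h1 := hlow r hr
    have h2 := (hy r hr).1
    by_contra hcon
    nlinarith [mul_nonneg hc0 h2]
  by_cases hDw : w < D
  · refine ⟨1, -j, 0, -1, -k, w, Or.inr (by ring), fun r hr => ⟨?_, ?_, ?_⟩⟩
    · linarith [hxk r hr]
    · linarith [(hy r hr).2]
    · by_contra hcon
      push Not at hcon
      have h1 := hup r hr
      obtain ⟨h2, h3⟩ := hy r hr
      have h4 : D + 1 ≤ r.1 - j * r.2 - r.2 - k + w := by linarith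
      have h5 : w * (D + 1) ≤ w * (r.1 - j * r.2 - r.2 - k + w) :=
        mul_le_mul_of_nonneg_left h4 (by omega)
      have h6 : 0 ≤ (w - c) * r.2 := mul_nonneg (by omega) h2
      nlinarith
  · exfalso
    have hD2 : w * w ≤ 2 * D ∧ (c = 0 → w * w ≤ D) := by
      by_cases hc2 : 2 * c ≤ w
      · have h := hmin j k
        push Not at h
        obtain ⟨r, hr, h⟩ := h
        have h := h (hxk r hr)
        have h1 := hup r hr
        obtain ⟨h2, h3⟩ := hy r hr
        have h5 : w * (k + w) ≤ w * (r.1 - j * r.2) :=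
          mul_le_mul_of_nonneg_left (by omega) (by omega)
        have h6 : c * r.2 ≤ c * w := mul_le_mul_of_nonneg_left h3 hc0
        constructor
        · nlinarith
        · rintro rfl; nlinarith
      · refine ⟨?_, fun h => by omega⟩
        obtain ⟨K, hK1, hK2⟩ : ∃ K : ℤ, w * K ≤ m0 + D ∧ m0 + D < w * (K + 1) :=
          ⟨(m0 + D) / w, Int.mul_ediv_self_le (by omega),
            by nlinarith [Int.lt_mul_ediv_self_add (x := m0 + D) (k := w) (by omega)]⟩
        have h := hmin (j + 1) (K - w + 1)
        push Not at h
        obtain ⟨r, hr, h⟩ := h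
        have h1 := hup r hr
        have h1' := hlow r hr
        obtain ⟨h2, h3⟩ := hy r hr
        have h7 : r.1 - (j + 1) * r.2 ≤ K := by
          by_contra hcon
          have h6 : 0 ≤ (w - c) * r.2 := mul_nonneg (by omega) h2
          nlinarith
        have h8 : r.1 - (j + 1) * r.2 ≤ K - w := by
          by_contra hcon
          have := h (by omega)
          omega
        have h5 : w * (r.1 - (j + 1) * r.2) ≤ w * (K - w) :=
          mul_le_mul_of_nonneg_left h8 (by omega)
        have h6 : (w - c) * r.2 ≤ (w - c) * w := mul_le_mul_of_nonneg_left h3 (by omega)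
        nlinarith
    obtain ⟨hD2, hD3⟩ := hD2
    have hw2 : w = 2 := by nlinarith
    subst hw2
    have hDD : D = 2 := by omega
    subst hDD
    have hc1 : c = 1 := by
      have : c ≠ 0 := fun h => by have := hD3 h; omega
      omega
    subst hc1
    have hpj := hlow p hpS
    have hpj' := hup p hpS
    rw [hp] at hpj hpj'
    have A := hmin j p.1
    have B := hmin (j + 1) (p.1 - 1)
    push Not at A B
    obtain ⟨r, hr, A⟩ := A
    obtain ⟨s, hs, B⟩ := B
    have hr1 := hlow r hr
    have hr2 := hup r hr
    have hs1 := hlow s hs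
    have hs2 := hup s hs
    obtain ⟨hr3, hr4⟩ := hy r hr
    obtain ⟨hs3, hs4⟩ := hy s hs
    have d1 := hD p hpS s hs r hr q hqS
    have d2 := hD s hs p hpS r hr q hqS
    have d3 := hD p hpS r hr s hs q hqS
    have d4 := hD r hr p hpS s hs q hqS
    clear hD hy hmin hr0min hlow hup hxk
    obtain ⟨p1, p2⟩ := p
    obtain ⟨q1, q2⟩ := q
    obtain ⟨r1, r2⟩ := r
    obtain ⟨s1, s2⟩ := s
    simp only at *
    subst hp hq
    obtain rfl : q1 = p1 + j * 2 + 1 := by omega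
    obtain ⟨u, rfl⟩ : ∃ u, r1 = p1 + j * r2 + u := ⟨r1 - p1 - j * r2, by ring⟩
    obtain ⟨v, rfl⟩ : ∃ v, s1 = p1 + j * s2 + v := ⟨s1 - p1 - j * s2, by ring⟩
    clear hm0 hC
    clear_value m0
    interval_cases r2 <;> interval_cases s2 <;> ring_nf at * <;> omega

/-- Normalised integer core, width one. -/
lemma core_one (S : Set (ℤ × ℤ)) (hS : S.Finite) (D : ℤ)
    (hD : ∀ p ∈ S, ∀ q ∈ S, ∀ r ∈ S, ∀ s ∈ S,
      (q.1 - p.1) * (s.2 - r.2) - (q.2 - p.2) * (s.1 - r.1) ≤ D)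
    (hy : ∀ p ∈ S, 0 ≤ p.2 ∧ p.2 ≤ 1)
    (hb : ∃ p ∈ S, p.2 = 0) (ht : ∃ p ∈ S, p.2 = 1)
    (hmin : ∀ j k : ℤ, ¬ ∀ p ∈ S, k ≤ p.1 - j * p.2 ∧ p.1 - j * p.2 ≤ k + 1 - 1) :
    ∃ a b c d e f : ℤ, (a * d - b * c = 1 ∨ a * d - b * c = -1) ∧ ∀ p ∈ S,
      0 ≤ a * p.1 + b * p.2 + e ∧ 0 ≤ c * p.1 + d * p.2 + f ∧
      (a * p.1 + b * p.2 + e) + (c * p.1 + d * p.2 + f) ≤ D := by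
  have hB : {p ∈ S | p.2 = 0}.Finite := hS.subset (fun _ h => h.1)
  have hT : {p ∈ S | p.2 = 1}.Finite := hS.subset (fun _ h => h.1)
  obtain ⟨p, ⟨hpS, hp⟩, hpm⟩ := Set.exists_min_image _ (fun r : ℤ × ℤ => r.1) hB hb
  obtain ⟨p', ⟨hpS', hp'⟩, hpm'⟩ := Set.exists_max_image _ (fun r : ℤ × ℤ => r.1) hB hb
  obtain ⟨q, ⟨hqS, hq⟩, hqm⟩ := Set.exists_max_image _ (fun r : ℤ × ℤ => r.1) hT ht
  obtain ⟨q', ⟨hqS', hq'⟩, hqm'⟩ := Set.exists_min_image _ (fun r : ℤ × ℤ => r.1) hT ht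
  have hcase : ∀ r ∈ S, (r.2 = 0 ∧ p.1 ≤ r.1 ∧ r.1 ≤ p'.1) ∨
      (r.2 = 1 ∧ q'.1 ≤ r.1 ∧ r.1 ≤ q.1) := by
    intro r hr
    have h := hy r hr
    have : r.2 = 0 ∨ r.2 = 1 := by omega
    rcases this with h0 | h1
    · exact Or.inl ⟨h0, hpm r ⟨hr, h0⟩, hpm' r ⟨hr, h0⟩⟩
    · exact Or.inr ⟨h1, hqm' r ⟨hr, h1⟩, hqm r ⟨hr, h1⟩⟩
  have hab : (p'.1 - p.1) + (q.1 - q'.1) ≤ D := by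
    have := hD p hpS q hqS p' hpS' q' hqS'
    rw [hp, hq, hp', hq'] at this
    linarith
  have ha : p.1 ≤ p'.1 := hpm p' ⟨hpS', hp'⟩
  have hbb : q'.1 ≤ q.1 := hqm q' ⟨hqS', hq'⟩
  have hpos : 1 ≤ (p'.1 - p.1) + (q.1 - q'.1) := by
    by_contra hcon
    refine hmin (q.1 - p.1) p.1 (fun r hr => ?_)
    rcases hcase r hr with ⟨h, h1, h2⟩ | ⟨h, h1, h2⟩ <;> rw [h] <;> constructor <;> linarith
  by_cases ha1 : p.1 < p'.1
  · refine ⟨1, -(q'.1 - p.1), 0, 1, -p.1, 0, Or.inl (by ring), fun r hr => ?_⟩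
    rcases hcase r hr with ⟨h, h1, h2⟩ | ⟨h, h1, h2⟩ <;> rw [h] <;>
      refine ⟨?_, ?_, ?_⟩ <;> linarith
  · refine ⟨1, -(q'.1 - p.1), 0, -1, -p.1, 1, Or.inr (by ring), fun r hr => ?_⟩
    rcases hcase r hr with ⟨h, h1, h2⟩ | ⟨h, h1, h2⟩ <;> rw [h] <;>
      refine ⟨?_, ?_, ?_⟩ <;> linarith

/-- The integer statement without normalisation. -/
lemma core_all (S : Set (ℤ × ℤ)) (hS : S.Finite) (D : ℤ)
    (hD : ∀ p ∈ S, ∀ q ∈ S, ∀ r ∈ S, ∀ s ∈ S,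
      (q.1 - p.1) * (s.2 - r.2) - (q.2 - p.2) * (s.1 - r.1) ≤ D)
    (hnd : ∀ c d f : ℤ, (c ≠ 0 ∨ d ≠ 0) → ¬ ∀ p ∈ S, c * p.1 + d * p.2 + f = 0) :
    ∃ a b c d e f : ℤ, (a * d - b * c = 1 ∨ a * d - b * c = -1) ∧ ∀ p ∈ S,
      0 ≤ a * p.1 + b * p.2 + e ∧ 0 ≤ c * p.1 + d * p.2 + f ∧
      (a * p.1 + b * p.2 + e) + (c * p.1 + d * p.2 + f) ≤ D := by
  classical
  let W : ℕ → Prop := fun n => ∃ a b c d f : ℤ, a * d - b * c = 1 ∧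
    ∀ p ∈ S, 0 ≤ c * p.1 + d * p.2 + f ∧ c * p.1 + d * p.2 + f ≤ n
  have hex : ∃ n, W n := by
    obtain ⟨M, hM⟩ := (hS.image (fun p : ℤ × ℤ => p.2)).bddAbove
    obtain ⟨m, hm⟩ := (hS.image (fun p : ℤ × ℤ => p.2)).bddBelow
    refine ⟨(M - m).toNat, 1, 0, 0, 1, -m, by ring, fun p hp => ?_⟩
    have h1 := hM (Set.mem_image_of_mem _ hp)
    have h2 := hm (Set.mem_image_of_mem _ hp)
    omega
  obtain ⟨a, b, c, d, f, hdet, hf⟩ := Nat.find_spec hex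
  have hmn : ∀ n < Nat.find hex, ¬ W n := fun n hn => Nat.find_min hex hn
  generalize Nat.find hex = w at hf hmn
  have hw : 1 ≤ w := by
    by_contra hcon
    obtain rfl : w = 0 := by omega
    refine hnd c d f ?_ (fun p hp => le_antisymm (by simpa using (hf p hp).2) (hf p hp).1)
    by_contra hcd
    push Not at hcd
    rw [hcd.1, hcd.2] at hdet
    simp at hdet
  have hmn' : ∀ a b c d f : ℤ, a * d - b * c = 1 →
      ¬ ∀ p ∈ S, 0 ≤ c * p.1 + d * p.2 + f ∧ c * p.1 + d * p.2 + f ≤ (w : ℤ) - 1 := by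
    intro a b c d f h1 h2
    refine hmn (w - 1) (by omega) ⟨a, b, c, d, f, h1, fun p hp => ⟨(h2 p hp).1, ?_⟩⟩
    have := (h2 p hp).2
    omega
  let g : ℤ × ℤ → ℤ × ℤ := fun p => (a * p.1 + b * p.2, c * p.1 + d * p.2 + f)
  have key : ∃ A B C E e h : ℤ, (A * E - B * C = 1 ∨ A * E - B * C = -1) ∧ ∀ p ∈ g '' S,
      0 ≤ A * p.1 + B * p.2 + e ∧ 0 ≤ C * p.1 + E * p.2 + h ∧
      (A * p.1 + B * p.2 + e) + (C * p.1 + E * p.2 + h) ≤ D := by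
    have hD' : ∀ p ∈ g '' S, ∀ q ∈ g '' S, ∀ r ∈ g '' S, ∀ s ∈ g '' S,
      (q.1 - p.1) * (s.2 - r.2) - (q.2 - p.2) * (s.1 - r.1) ≤ D := by
      rintro _ ⟨p, hp, rfl⟩ _ ⟨q, hq, rfl⟩ _ ⟨r, hr, rfl⟩ _ ⟨s, hs, rfl⟩
      have h := hD p hp q hq r hr s hs
      simp only [g]
      have : (a * q.1 + b * q.2 - (a * p.1 + b * p.2)) *
            (c * s.1 + d * s.2 + f - (c * r.1 + d * r.2 + f)) -
          (c * q.1 + d * q.2 + f - (c * p.1 + d * p.2 + f)) *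
            (a * s.1 + b * s.2 - (a * r.1 + b * r.2)) =
          (a * d - b * c) *
            ((q.1 - p.1) * (s.2 - r.2) - (q.2 - p.2) * (s.1 - r.1)) := by ring
      rw [this, hdet, one_mul]
      exact h
    have hy' : ∀ p ∈ g '' S, 0 ≤ p.2 ∧ p.2 ≤ (w : ℤ) := by
      rintro _ ⟨p, hp, rfl⟩
      exact hf p hp
    have hb' : ∃ p ∈ g '' S, p.2 = 0 := by
      by_contra hcon
      push Not at hcon
      refine hmn' a b c d (f - 1) hdet (fun p hp => ?_)
      have h1 := hcon _ (Set.mem_image_of_mem g hp)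
      have h2 := hf p hp
      simp only [g] at h1
      omega
    have ht' : ∃ p ∈ g '' S, p.2 = (w : ℤ) := by
      by_contra hcon
      push Not at hcon
      refine hmn' a b c d f hdet (fun p hp => ?_)
      have h1 := hcon _ (Set.mem_image_of_mem g hp)
      have h2 := hf p hp
      simp only [g] at h1
      omega
    have hmin' : ∀ j k : ℤ, ¬ ∀ p ∈ g '' S,
        k ≤ p.1 - j * p.2 ∧ p.1 - j * p.2 ≤ k + (w : ℤ) - 1 := by
      intro j k h
      refine hmn' (-c) (-d) (a - j * c) (b - j * d) (-k - j * f) (by linarith) (fun p hp => ?_)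
      have h1 := h _ (Set.mem_image_of_mem g hp)
      simp only [g] at h1
      constructor <;> linarith [h1.1, h1.2]
    rcases Nat.lt_or_ge 1 w with h2 | h1
    · exact core_ge_two _ (hS.image g) D w (by omega) hD' hy' hb' ht' hmin'
    · obtain rfl : w = 1 := by omega
      exact core_one _ (hS.image g) D hD' (by simpa using hy') hb' (by simpa using ht')
        (by simpa using hmin')
  obtain ⟨A, B, C, E, e, h, hdet', hfin⟩ := key
  refine ⟨A * a + B * c, A * b + B * d, C * a + E * c, C * b + E * d, B * f + e, E * f + h,
    ?_, fun p hp => ?_⟩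
  · have : (A * a + B * c) * (C * b + E * d) - (A * b + B * d) * (C * a + E * c) =
        (A * E - B * C) * (a * d - b * c) := by ring
    rw [this, hdet, mul_one]
    exact hdet'
  · obtain ⟨h1, h2, h3⟩ := hfin _ (Set.mem_image_of_mem g hp)
    simp only [g] at h1 h2 h3
    refine ⟨?_, ?_, ?_⟩ <;> linarith

/-- The open standard triangle. -/
lemma volume_open_triangle :
    volume {x : Fin 2 → ℝ | 0 < x 0 ∧ 0 < x 1 ∧ x 0 + x 1 < 1} = ENNReal.ofReal (1 / 2) := by
  have h := (volume_preserving_finTwoArrow ℝ).measure_preimage_equiv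
    (regionBetween (fun _ => (0 : ℝ)) (fun x => 1 - x) (Ioo 0 1))
  have hset : (MeasurableEquiv.finTwoArrow : (Fin 2 → ℝ) ≃ᵐ ℝ × ℝ) ⁻¹'
      (regionBetween (fun _ => (0 : ℝ)) (fun x => 1 - x) (Ioo 0 1)) =
      {x : Fin 2 → ℝ | 0 < x 0 ∧ 0 < x 1 ∧ x 0 + x 1 < 1} := by
    ext x
    simp only [regionBetween, mem_preimage, mem_ofPred_eq, mem_Ioo,
      MeasurableEquiv.finTwoArrow_apply]
    constructor
    · rintro ⟨⟨h1, h2⟩, h3, h4⟩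
      exact ⟨h1, h3, by linarith⟩
    · rintro ⟨h1, h2, h3⟩
      exact ⟨⟨h1, by linarith⟩, h2, by linarith⟩
  rw [hset] at h
  rw [h]
  have hv : (volume : Measure (ℝ × ℝ)) = (volume : Measure ℝ).prod volume := rfl
  have hint : IntegrableOn (fun x : ℝ => 1 - x) (Ioo 0 1) :=
    (Continuous.integrableOn_Icc (by fun_prop)).mono_set Ioo_subset_Icc_self
  rw [hv, volume_regionBetween_eq_integral (by simp) hint measurableSet_Ioo
    (fun x hx => by linarith [hx.2])]
  congr 1
  rw [← integral_Ioc_eq_integral_Ioo, ← intervalIntegral.integral_of_le (by norm_num)]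
  simp only [Pi.sub_apply, sub_zero]
  rw [intervalIntegral.integral_sub (by simp) (by simp)]
  simp
  norm_num

/-- Twice the signed area of a triangle. -/
noncomputable def triDet (p q x : Fin 2 → ℝ) : ℝ :=
  (q 0 - p 0) * (x 1 - p 1) - (q 1 - p 1) * (x 0 - p 0)

lemma half_triangle (P : Set (Fin 2 → ℝ)) (hP : Convex ℝ P) (p q s : Fin 2 → ℝ)
    (hp : p ∈ P) (hq : q ∈ P) (hs : s ∈ P) :
    ENNReal.ofReal (|triDet p q s| / 2) ≤
      volume (P ∩ {x | 0 < triDet p q x * triDet p q s}) := by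
  by_cases h0 : triDet p q s = 0
  · simp [h0]
  let M : Matrix (Fin 2) (Fin 2) ℝ := !![q 0 - p 0, s 0 - p 0; q 1 - p 1, s 1 - p 1]
  have hdet : LinearMap.det (Matrix.toLin' M) = triDet p q s := by
    rw [LinearMap.det_toLin', Matrix.det_fin_two]
    simp only [M, triDet]
    simp
    ring
  have himg := Measure.addHaar_image_linearMap volume (Matrix.toLin' M)
    {x : Fin 2 → ℝ | 0 < x 0 ∧ 0 < x 1 ∧ x 0 + x 1 < 1}
  rw [hdet, volume_open_triangle, ← ENNReal.ofReal_mul (abs_nonneg _)] at himg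
  have hle : p +ᵥ (Matrix.toLin' M '' {x : Fin 2 → ℝ | 0 < x 0 ∧ 0 < x 1 ∧ x 0 + x 1 < 1}) ⊆
      P ∩ {x | 0 < triDet p q x * triDet p q s} := by
    rintro _ ⟨_, ⟨x, ⟨h1, h2, h3⟩, rfl⟩, rfl⟩
    have hform : (p +ᵥ Matrix.toLin' M x : Fin 2 → ℝ) =
        (1 - x 0 - x 1) • p + x 0 • q + x 1 • s := by
      ext i
      fin_cases i <;>
      · simp [M, Matrix.toLin'_apply, Matrix.mulVec, dotProduct, Fin.sum_univ_two]
        ring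
    simp only []
    rw [hform]
    constructor
    · have := hP.sum_mem (t := Finset.univ) (w := ![1 - x 0 - x 1, x 0, x 1]) (z := ![p, q, s])
        (by intro i _; fin_cases i <;> simp <;> linarith)
        (by simp [Fin.sum_univ_three]; ring)
        (by intro i _; fin_cases i <;> simp [hp, hq, hs])
      simpa [Fin.sum_univ_three] using this
    · have : triDet p q ((1 - x 0 - x 1) • p + x 0 • q + x 1 • s) = x 1 * triDet p q s := by
        simp [triDet]; ring
      simp only [mem_ofPred_eq]
      rw [this, mul_assoc]
      have : 0 < triDet p q s * triDet p q s := mul_self_pos.2 h0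
      positivity
  calc ENNReal.ofReal (|triDet p q s| / 2)
      = volume (p +ᵥ (Matrix.toLin' M ''
          {x : Fin 2 → ℝ | 0 < x 0 ∧ 0 < x 1 ∧ x 0 + x 1 < 1})) := by
        rw [measure_vadd, himg]; congr 1; ring
    _ ≤ _ := measure_mono hle

lemma quad_area (P : Set (Fin 2 → ℝ)) (hP : Convex ℝ P) (hfin : volume P ≠ ⊤)
    (p q r s : Fin 2 → ℝ) (hp : p ∈ P) (hq : q ∈ P) (hr : r ∈ P) (hs : s ∈ P) :
    (q 0 - p 0) * (s 1 - r 1) - (q 1 - p 1) * (s 0 - r 0) ≤ 2 * (volume P).toReal := by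
  have heq : (q 0 - p 0) * (s 1 - r 1) - (q 1 - p 1) * (s 0 - r 0) =
      triDet p q s - triDet p q r := by simp only [triDet]; ring
  rw [heq]
  have h1 := half_triangle P hP p q s hp hq hs
  have h2 := half_triangle P hP p q r hp hq hr
  have single : ∀ x ∈ P, |triDet p q x| ≤ 2 * (volume P).toReal := by
    intro x hx
    have h := (half_triangle P hP p q x hp hq hx).trans (measure_mono inter_subset_left)
    rw [ENNReal.ofReal_le_iff_le_toReal hfin] at h
    linarith
  by_cases hsg : 0 < triDet p q s ∧ triDet p q r < 0
  · obtain ⟨hs0, hr0⟩ := hsg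
    have hmeas : MeasurableSet {x | 0 < triDet p q x * triDet p q s} := by
      apply IsOpen.measurableSet
      apply isOpen_lt continuous_const
      unfold triDet
      fun_prop
    have hdisj : Disjoint (P ∩ {x | 0 < triDet p q x * triDet p q r})
        (P ∩ {x | 0 < triDet p q x * triDet p q s}) := by
      rw [Set.disjoint_left]
      rintro x ⟨_, hx⟩ ⟨_, hx'⟩
      simp only [mem_ofPred_eq] at hx hx'
      have : 0 < triDet p q x := pos_of_mul_pos_left hx' hs0.le
      nlinarith
    have hadd : volume (P ∩ {x | 0 < triDet p q x * triDet p q s}) +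
        volume (P ∩ {x | 0 < triDet p q x * triDet p q r}) ≤ volume P := by
      rw [← measure_inter_add_sdiff P hmeas]
      gcongr
      rintro x ⟨hx, hx'⟩
      exact ⟨hx, fun h => Set.disjoint_left.1 hdisj ⟨hx, hx'⟩ ⟨hx, h⟩⟩
    have h := (add_le_add h1 h2).trans hadd
    rw [← ENNReal.ofReal_add (by positivity) (by positivity),
      ENNReal.ofReal_le_iff_le_toReal hfin, abs_of_pos hs0, abs_of_neg hr0] at h
    linarith
  · have a1 := single s hs
    have a2 := single r hr
    have b1 := le_abs_self (triDet p q s)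
    have b2 := neg_abs_le (triDet p q r)
    have b3 := abs_nonneg (triDet p q s)
    rcases not_and_or.1 hsg with h | h <;> linarith

lemma line_null (S : Set (Fin 2 → ℝ)) (c d f : ℝ) (hcd : c ≠ 0 ∨ d ≠ 0)
    (h : ∀ x ∈ S, c * x 0 + d * x 1 + f = 0) : volume (convexHull ℝ S) = 0 := by
  rcases S.eq_empty_or_nonempty with rfl | ⟨p, hp⟩
  · simp
  let l : (Fin 2 → ℝ) →ₗ[ℝ] ℝ := c • LinearMap.proj 0 + d • LinearMap.proj 1
  have hl : ∀ x, l x = c * x 0 + d * x 1 := fun x => by simp [l]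
  have hsub : convexHull ℝ S ⊆ (AffineSubspace.mk' p (LinearMap.ker l) : Set (Fin 2 → ℝ)) := by
    refine convexHull_min (fun x hx => ?_) (AffineSubspace.convex _)
    rw [SetLike.mem_coe, AffineSubspace.mem_mk', LinearMap.mem_ker, vsub_eq_sub, map_sub, hl, hl]
    linarith [h x hx, h p hp]
  refine measure_mono_null hsub (Measure.addHaar_affineSubspace _ _ ?_)
  intro htop
  have h2 : LinearMap.ker l = ⊤ := by
    rw [← AffineSubspace.direction_mk' p (LinearMap.ker l), htop, AffineSubspace.direction_top]
  have h3 : ∀ x, l x = 0 := fun x => LinearMap.mem_ker.1 (h2 ▸ Submodule.mem_top)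
  have h4 := h3 ![1, 0]
  have h5 := h3 ![0, 1]
  rw [hl] at h4 h5
  simp at h4 h5
  exact hcd.elim (fun h => h h4) (fun h => h h5)

/-- A convex lattice polygon `P` of nonzero area satisfies `A(P) ≥ ls_Δ(P)/2`;
equivalently, some unimodular image of `P` is contained in `2·A(P)·Δ`. -/
theorem stmt7 (P : Set (Fin 2 → ℝ)) (hP : IsLatticePolygon P) (hA : area P ≠ 0) :
    lsDelta P / 2 ≤ area P ∧
    ∃ φ, IsUnimodularMap φ ∧ φ '' P ⊆ simplexDilate (2 * area P) := by
  have hmain : ∃ φ, IsUnimodularMap φ ∧ φ '' P ⊆ simplexDilate (2 * area P) := by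
    obtain ⟨S, hSne, hPS⟩ := hP
    have hconv : Convex ℝ P := hPS ▸ convex_convexHull ℝ _
    have hfin : volume P ≠ ⊤ := fun h => hA (by simp [area, h])
    have hmem : ∀ p ∈ S, (fun i => (p i : ℝ)) ∈ P := fun p hp => by
      rw [hPS]; exact subset_convexHull ℝ _ ⟨p, hp, rfl⟩
    let T : Set (ℤ × ℤ) := (fun p : Fin 2 → ℤ => (p 0, p 1)) '' (S : Set (Fin 2 → ℤ))
    obtain ⟨a, b, c, d, e, f, hdet, hfit⟩ := core_all T (S.finite_toSet.image _) ⌊2 * area P⌋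
      (by
        rintro _ ⟨p, hp, rfl⟩ _ ⟨q, hq, rfl⟩ _ ⟨r, hr, rfl⟩ _ ⟨s, hs, rfl⟩
        rw [Int.le_floor]
        push_cast
        exact quad_area P hconv hfin _ _ _ _ (hmem p hp) (hmem q hq) (hmem r hr) (hmem s hs))
      (by
        intro c d f hcd h
        apply hA
        have : volume P = 0 := by
          rw [hPS]
          refine line_null _ c d f (by exact_mod_cast hcd) ?_
          rintro _ ⟨p, hp, rfl⟩
          have := h _ ⟨p, hp, rfl⟩
          simp only at this ⊢
          exact_mod_cast this
        simp [area, this])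
    let φ : (Fin 2 → ℝ) → (Fin 2 → ℝ) := fun x =>
      ((!![a, b; c, d] : Matrix (Fin 2) (Fin 2) ℤ).map (Int.cast : ℤ → ℝ)).mulVec x +
        fun i => ((![e, f] i : ℤ) : ℝ)
    have hφ0 : ∀ x, φ x 0 = a * x 0 + b * x 1 + e := fun x => by
      simp [φ, Matrix.vecHead, Matrix.vecTail]
    have hφ1 : ∀ x, φ x 1 = c * x 0 + d * x 1 + f := fun x => by
      simp [φ, Matrix.vecHead, Matrix.vecTail]
    refine ⟨φ, ⟨!![a, b; c, d], ![e, f], ?_, fun x => rfl⟩, ?_⟩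
    · rw [Matrix.det_fin_two_of]; exact hdet
    · rw [image_subset_iff, hPS]
      refine convexHull_min ?_ ?_
      · rintro _ ⟨p, hp, rfl⟩
        obtain ⟨h1, h2, h3⟩ := hfit _ ⟨p, hp, rfl⟩
        rw [Int.le_floor] at h3
        rw [← hPS]
        simp only [mem_preimage, simplexDilate, mem_ofPred_eq, hφ0, hφ1]
        push_cast at h3
        exact ⟨by exact_mod_cast h1, by exact_mod_cast h2, h3⟩
      · intro x hx y hy α β hα hβ hαβ
        simp only [mem_preimage, simplexDilate, mem_ofPred_eq, hφ0, hφ1, Pi.add_apply,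
          Pi.smul_apply, smul_eq_mul] at hx hy ⊢
        obtain ⟨x1, x2, x3⟩ := hx
        obtain ⟨y1, y2, y3⟩ := hy
        obtain rfl : β = 1 - α := by linarith
        refine ⟨?_, ?_, ?_⟩
        · nlinarith [mul_nonneg hα x1, mul_nonneg hβ y1]
        · nlinarith [mul_nonneg hα x2, mul_nonneg hβ y2]
        · nlinarith [mul_le_mul_of_nonneg_left x3 hα, mul_le_mul_of_nonneg_left y3 hβ]
  refine ⟨?_, hmain⟩
  have h : lsDelta P ≤ 2 * area P :=
    csInf_le ⟨0, fun l hl => hl.1⟩ ⟨mul_nonneg (by norm_num) ENNReal.toReal_nonneg, hmain⟩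
  linarith
end

section
/- Let P ⊂ ℝ² be a convex lattice polygon of nonzero area with l = ls_Δ(P). Then A(P) = l/2 if and only if P is lattice-equivalent to one of the following: (a) conv{(0,0), (l,0), (0,1)} for some integer l ≥ 1; (b) the unit square [0,1]², in which case l = 2; (c) the triangle conv{(0,0), (1,2), (2,1)}, in which case l = 3. -/
open Set MeasureTheory Pointwise

set_option linter.unusedSimpArgs false

/-- A real affine map of the plane given by a matrix and a translation. -/
def affM (M : Matrix (Fin 2) (Fin 2) ℝ) (t : Fin 2 → ℝ) : (Fin 2 → ℝ) →ᵃ[ℝ] (Fin 2 → ℝ) :=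
  (Matrix.toLin' M).toAffineMap + AffineMap.const ℝ (Fin 2 → ℝ) t

theorem affM_apply (M : Matrix (Fin 2) (Fin 2) ℝ) (t x : Fin 2 → ℝ) :
    affM M t x = M.mulVec x + t := by
  simp [affM]

theorem volume_affM (M : Matrix (Fin 2) (Fin 2) ℝ) (t : Fin 2 → ℝ) (s : Set (Fin 2 → ℝ)) :
    volume (affM M t '' s) = ENNReal.ofReal |M.det| * volume s := by
  have h : affM M t '' s = (fun x => x + t) '' (Matrix.toLin' M '' s) := by
    rw [Set.image_image]
    apply Set.image_congr
    intro x _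
    rw [affM_apply, Matrix.toLin'_apply]
  rw [h]
  have h2 : volume ((fun x => x + t) '' (Matrix.toLin' M '' s)) =
      volume (Matrix.toLin' M '' s) := by
    rw [Set.image_add_right, measure_preimage_add_right]
  rw [h2, Measure.addHaar_image_linearMap, LinearMap.det_toLin']

theorem volume_hyp (i : Fin 2) (c : ℝ) : volume {x : Fin 2 → ℝ | x i = c} = 0 := by
  exact Measure.pi_hyperplane (fun _ : Fin 2 => (volume : Measure ℝ)) i c

theorem volume_diag : volume {x : Fin 2 → ℝ | x 0 + x 1 = 1} = 0 := by
  have h : {x : Fin 2 → ℝ | x 0 + x 1 = 1} ⊆ affM !![1, 0; -1, 1] 0 '' {x | x 1 = 1} := by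
    intro x hx
    refine ⟨![x 0, 1], by simp, ?_⟩
    rw [affM_apply]
    simp only [mem_ofPred_eq] at hx
    ext i
    fin_cases i <;> simp [Matrix.mulVec, dotProduct]
    linarith
  refine measure_mono_null h ?_
  rw [volume_affM, volume_hyp, mul_zero]

theorem measurable_T : MeasurableSet (simplexDilate 1) := by
  unfold simplexDilate
  apply IsClosed.measurableSet
  refine IsClosed.and (isClosed_le (by fun_prop) (by fun_prop)) ?_
  exact IsClosed.and (isClosed_le (by fun_prop) (by fun_prop)) (isClosed_le (by fun_prop) (by fun_prop))

theorem volume_square : volume (squareDilate 1) = 1 := by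
  have : squareDilate 1 = Set.Icc (0 : Fin 2 → ℝ) 1 := by
    ext x
    simp only [squareDilate, mem_ofPred_eq, Set.mem_Icc, Pi.le_def, Pi.zero_apply, Pi.one_apply]
    exact forall_and
  rw [this, Real.volume_Icc_pi]
  simp

theorem volume_T : volume (simplexDilate 1) = ENNReal.ofReal (1 / 2) := by
  set R : Set (Fin 2 → ℝ) := affM (-1) 1 '' (simplexDilate 1 \ {x | x 0 + x 1 = 1}) with hR
  have h1 : squareDilate 1 = simplexDilate 1 ∪ R := by
    ext x
    simp only [squareDilate, simplexDilate, hR, Set.mem_union, Set.mem_image, mem_ofPred_eq,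
      Fin.forall_fin_two, Set.mem_Icc, Set.mem_sdiff, affM_apply]
    constructor
    · rintro ⟨⟨h0, h1⟩, h2, h3⟩
      by_cases h : x 0 + x 1 ≤ 1
      · exact Or.inl ⟨h0, h2, h⟩
      · right
        refine ⟨1 - x, ⟨⟨?_, ?_, ?_⟩, ?_⟩, ?_⟩
        · simp; linarith
        · simp; linarith
        · simp; linarith
        · simp only [Pi.sub_apply, Pi.one_apply]
          intro h'
          apply h
          linarith
        · ext i
          simp [Matrix.neg_mulVec]
    · rintro (⟨h0, h1, h2⟩ | ⟨y, ⟨⟨h0, h1, h2⟩, h3⟩, rfl⟩)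
      · refine ⟨⟨?_, ?_⟩, ?_, ?_⟩ <;> linarith
      · simp [Matrix.neg_mulVec]
        refine ⟨⟨?_, ?_⟩, ?_, ?_⟩ <;> linarith
  have h2 : Disjoint R (simplexDilate 1) := by
    rw [Set.disjoint_left]
    rintro _ ⟨y, ⟨⟨h0, h1, h2⟩, h3⟩, rfl⟩ ⟨h4, h5, h6⟩
    simp [Matrix.neg_mulVec, affM_apply] at h4 h5 h6
    simp only [mem_ofPred_eq] at h3
    apply h3
    linarith
  have h3 : volume R = volume (simplexDilate 1) := by
    rw [hR, volume_affM, measure_sdiff_null volume_diag]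
    simp [Matrix.det_neg]
  have h4 : volume (squareDilate 1) = volume R + volume (simplexDilate 1) := by
    rw [h1, Set.union_comm, measure_union h2 measurable_T]
  rw [volume_square, h3, ← two_mul] at h4
  have : volume (simplexDilate 1) = 1 / 2 := by
    rw [ENNReal.eq_div_iff (by norm_num) (by norm_num), ← h4]
  rw [this, ENNReal.ofReal_div_of_pos (by norm_num)]
  simp

/-- matrix of the triangle with vertices `p, q, r` -/
def triM (p q r : Fin 2 → ℝ) : Matrix (Fin 2) (Fin 2) ℝ :=
  !![q 0 - p 0, r 0 - p 0; q 1 - p 1, r 1 - p 1]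

theorem triM_det (p q r : Fin 2 → ℝ) :
    (triM p q r).det = (q 0 - p 0) * (r 1 - p 1) - (r 0 - p 0) * (q 1 - p 1) := by
  simp [triM, Matrix.det_fin_two]

theorem tri_apply (p q r x : Fin 2 → ℝ) :
    affM (triM p q r) p x = (1 - x 0 - x 1) • p + x 0 • q + x 1 • r := by
  rw [affM_apply]
  ext i
  fin_cases i <;> simp [triM, Matrix.mulVec, dotProduct] <;> ring

theorem tri_subset (p q r : Fin 2 → ℝ) {P : Set (Fin 2 → ℝ)} (hP : Convex ℝ P) (hp : p ∈ P)
    (hq : q ∈ P) (hr : r ∈ P) : affM (triM p q r) p '' simplexDilate 1 ⊆ P := by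
  rintro _ ⟨x, ⟨h0, h1, h2⟩, rfl⟩
  rw [tri_apply]
  have := hP.sum_mem (t := Finset.univ) (w := ![1 - x 0 - x 1, x 0, x 1]) (z := ![p, q, r])
    (by intro i _; fin_cases i <;> simp <;> linarith)
    (by simp [Fin.sum_univ_three]; ring) (by intro i _; fin_cases i <;> simp [*])
  simpa [Fin.sum_univ_three] using this

theorem convex_simplex (l : ℝ) : Convex ℝ (simplexDilate l) := by
  rintro x ⟨h0, h1, h2⟩ y ⟨k0, k1, k2⟩ a b ha hb hab
  refine ⟨?_, ?_, ?_⟩ <;> simp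
  · positivity
  · positivity
  · have e : b = 1 - a := by linarith
    nlinarith

theorem tri_eq (p q r : Fin 2 → ℝ) :
    affM (triM p q r) p '' simplexDilate 1 = convexHull ℝ {p, q, r} := by
  apply Set.Subset.antisymm
  · apply tri_subset _ _ _ (convex_convexHull ℝ _) <;> apply subset_convexHull <;> simp
  · apply convexHull_min
    · rintro x (rfl | rfl | rfl)
      · exact ⟨![0, 0], by simp [simplexDilate], by rw [tri_apply]; simp⟩
      · exact ⟨![1, 0], by simp [simplexDilate], by rw [tri_apply]; simp⟩
      · exact ⟨![0, 1], by simp [simplexDilate], by rw [tri_apply]; simp⟩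
    · exact (convex_simplex 1).affine_image _

theorem volume_tri (p q r : Fin 2 → ℝ) : area (convexHull ℝ {p, q, r}) =
    |(q 0 - p 0) * (r 1 - p 1) - (r 0 - p 0) * (q 1 - p 1)| / 2 := by
  rw [area, ← tri_eq, volume_affM, volume_T, triM_det, ← ENNReal.ofReal_mul (abs_nonneg _),
    ENNReal.toReal_ofReal (by positivity)]
  ring

/-- half-open simplex -/
theorem volume_U : volume (simplexDilate 1 \ {x | x 1 = 0}) = ENNReal.ofReal (1 / 2) := by
  rw [measure_sdiff_null (volume_hyp 1 0), volume_T]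

/-- Main determinant bound. -/
theorem det_le {P : Set (Fin 2 → ℝ)} (hP : Convex ℝ P) (hf : volume P ≠ ⊤) {p q r s : Fin 2 → ℝ}
    (hp : p ∈ P) (hq : q ∈ P) (hr : r ∈ P) (hs : s ∈ P) :
    |(q 0 - p 0) * (s 1 - r 1) - (s 0 - r 0) * (q 1 - p 1)| ≤ 2 * area P := by
  set f : (Fin 2 → ℝ) → ℝ := fun x => (q 0 - p 0) * (x 1 - p 1) - (x 0 - p 0) * (q 1 - p 1) with hfd
  have e : (q 0 - p 0) * (s 1 - r 1) - (s 0 - r 0) * (q 1 - p 1) = f s - f r := by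
    simp only [hfd]; ring
  have one : ∀ x ∈ P, |f x| ≤ 2 * area P := by
    intro x hx
    have h1 := volume_tri p q x
    have h2 : area (convexHull ℝ {p, q, x}) ≤ area P := by
      apply ENNReal.toReal_mono hf
      apply measure_mono
      apply convexHull_min _ hP
      rintro y (rfl | rfl | rfl) <;> assumption
    simp only [hfd]
    linarith
  have two : ∀ x ∈ P, ∀ y ∈ P, 0 < f x → f y < 0 → f x - f y ≤ 2 * area P := by
    intro x hx y hy hfx hfy
    set X := affM (triM p q x) p '' (simplexDilate 1 \ {x | x 1 = 0}) with hX
    set Y := affM (triM p q y) p '' (simplexDilate 1 \ {x | x 1 = 0}) with hY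
    have key : ∀ z w, f (affM (triM p q z) p w) = w 1 * f z := by
      intro z w
      rw [tri_apply]
      simp [hfd]
      ring
    have hd : Disjoint X Y := by
      rw [Set.disjoint_left]
      rintro _ ⟨w, ⟨⟨_, h1, _⟩, h3⟩, rfl⟩ ⟨v, ⟨⟨_, k1, _⟩, k3⟩, hv⟩
      have a1 := key x w
      have a2 := key y v
      rw [hv] at a2
      have h1' : 0 < w 1 := lt_of_le_of_ne h1 (Ne.symm h3)
      have : 0 < w 1 * f x := by positivity
      have : v 1 * f y ≤ 0 := mul_nonpos_of_nonneg_of_nonpos k1 hfy.le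
      linarith
    have hXP : X ⊆ P := (Set.image_mono Set.sdiff_subset).trans (tri_subset p q x hP hp hq hx)
    have hYP : Y ⊆ P := (Set.image_mono Set.sdiff_subset).trans (tri_subset p q y hP hp hq hy)
    have vX : volume X = ENNReal.ofReal (f x / 2) := by
      rw [hX, volume_affM, volume_U, triM_det, ← ENNReal.ofReal_mul (abs_nonneg _)]
      rw [abs_of_pos (show 0 < _ from hfx)]
      congr 1
      simp only [hfd]; ring
    have vY : volume Y = ENNReal.ofReal (- f y / 2) := by
      rw [hY, volume_affM, volume_U, triM_det, ← ENNReal.ofReal_mul (abs_nonneg _)]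
      rw [abs_of_neg (show _ < 0 from hfy)]
      congr 1
      simp only [hfd]; ring
    have mX : MeasurableSet X := by
      have hdet : (triM p q x).det ≠ 0 := by rw [triM_det]; exact ne_of_gt hfx
      have hinj : Function.Injective (affM (triM p q x) p) := by
        intro u v huv
        rw [affM_apply, affM_apply, add_left_inj] at huv
        exact Matrix.mulVec_injective_of_isUnit
          ((Matrix.isUnit_iff_isUnit_det _).2 (isUnit_iff_ne_zero.2 hdet)) huv
      have hc : Continuous (affM (triM p q x) p) := AffineMap.continuous_of_finiteDimensional _
      refine MeasurableSet.image_of_continuousOn_injOn ?_ hc.continuousOn hinj.injOn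
      exact measurable_T.diff (measurableSet_eq_fun (by fun_prop) (by fun_prop))
    have hm : volume X + volume Y ≤ volume P := by
      rw [add_comm, ← measure_union hd.symm mX]
      exact measure_mono (Set.union_subset hYP hXP)
    rw [vX, vY, ← ENNReal.ofReal_add (by linarith) (by linarith)] at hm
    have := ENNReal.toReal_mono hf hm
    rw [ENNReal.toReal_ofReal (by linarith)] at this
    unfold area
    linarith
  rw [e]
  have hr1 := abs_le.1 (one r hr)
  have hs1 := abs_le.1 (one s hs)
  rw [abs_le]
  rcases lt_trichotomy (f r) 0 with h | h | h <;> rcases lt_trichotomy (f s) 0 with k | k | k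
  all_goals first
    | (constructor <;> linarith)
    | (have := two s hs r hr k h; constructor <;> linarith)
    | (have := two r hr s hs h k; constructor <;> linarith)

/-- Inclusion of the integer lattice in the plane. -/
def toR (p : Fin 2 → ℤ) : Fin 2 → ℝ := fun i => (p i : ℝ)

/-- Convex hull of a finite set of lattice points. -/
def hullZ (S : Finset (Fin 2 → ℤ)) : Set (Fin 2 → ℝ) :=
  convexHull ℝ (toR '' (S : Set (Fin 2 → ℤ)))

/-- Integer affine map in coordinates. -/
def mv (a b c d e f : ℤ) (p : Fin 2 → ℤ) : Fin 2 → ℤ :=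
  ![a * p 0 + b * p 1 + e, c * p 0 + d * p 1 + f]

theorem unimod_affM {φ : (Fin 2 → ℝ) → (Fin 2 → ℝ)} (h : IsUnimodularMap φ) :
    ∃ M t, |M.det| = 1 ∧ φ = affM M t := by
  obtain ⟨A, t, hd, hA⟩ := h
  refine ⟨A.map (Int.cast : ℤ → ℝ), fun i => (t i : ℝ), ?_, ?_⟩
  · have : (A.map (Int.cast : ℤ → ℝ)).det = (A.det : ℝ) := by
      simp [Matrix.det_fin_two]
    rw [this]
    rcases hd with h | h <;> simp [h]
  · funext x
    rw [hA, affM_apply]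

theorem area_equiv {P Q : Set (Fin 2 → ℝ)} (h : LatticeEquivalent P Q) : area Q = area P := by
  obtain ⟨φ, hφ, rfl⟩ := h
  obtain ⟨M, t, hM, rfl⟩ := unimod_affM hφ
  rw [area, volume_affM, hM, area]
  simp

theorem unimod_comp {φ ψ : (Fin 2 → ℝ) → (Fin 2 → ℝ)} (h : IsUnimodularMap φ)
    (k : IsUnimodularMap ψ) : IsUnimodularMap (ψ ∘ φ) := by
  obtain ⟨A, t, hd, hA⟩ := h
  obtain ⟨B, s, kd, hB⟩ := k
  refine ⟨B * A, B.mulVec t + s, ?_, ?_⟩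
  · rw [Matrix.det_mul]
    rcases hd with h | h <;> rcases kd with k | k <;> simp [h, k]
  · intro x
    rw [Function.comp, hB, hA]
    ext i
    fin_cases i <;>
    simp [Matrix.mulVec, dotProduct, Matrix.mul_apply, Fin.sum_univ_two, Matrix.vecHead,
      Matrix.vecTail] <;> ring

theorem equiv_trans {P Q R : Set (Fin 2 → ℝ)} (h : LatticeEquivalent P Q)
    (k : LatticeEquivalent Q R) : LatticeEquivalent P R := by
  obtain ⟨φ, hφ, rfl⟩ := h
  obtain ⟨ψ, hψ, rfl⟩ := k
  exact ⟨ψ ∘ φ, unimod_comp hφ hψ, by rw [Set.image_comp]⟩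

theorem equiv_refl (P : Set (Fin 2 → ℝ)) : LatticeEquivalent P P := by
  refine ⟨id, ⟨1, 0, Or.inl (by simp), ?_⟩, by simp⟩
  intro x
  ext i
  simp

theorem equiv_mv {P : Set (Fin 2 → ℝ)} {S : Finset (Fin 2 → ℤ)}
    (h : LatticeEquivalent P (hullZ S)) (a b c d e f : ℤ)
    (hd : a * d - b * c = 1 ∨ a * d - b * c = -1) :
    LatticeEquivalent P (hullZ (S.image (mv a b c d e f))) := by
  refine equiv_trans h ?_
  set M : Matrix (Fin 2) (Fin 2) ℝ := (!![a, b; c, d] : Matrix (Fin 2) (Fin 2) ℤ).map Int.cast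
    with hM
  refine ⟨affM M (toR ![e, f]), ⟨!![a, b; c, d], ![e, f], ?_, ?_⟩, ?_⟩
  · simpa [Matrix.det_fin_two] using hd
  · intro x
    rw [affM_apply]
    rfl
  · rw [hullZ, hullZ, AffineMap.image_convexHull, Finset.coe_image, Set.image_image, Set.image_image]
    congr 1
    apply Set.image_congr
    intro p _
    rw [affM_apply]
    ext i
    fin_cases i <;> simp [toR, mv, hM, Matrix.mulVec, dotProduct, Fin.sum_univ_two]

theorem hullZ_finite (S : Finset (Fin 2 → ℤ)) : volume (hullZ S) ≠ ⊤ := by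
  have : IsCompact (hullZ S) := (S.finite_toSet.image _).isCompact_convexHull ℝ
  exact this.measure_lt_top.ne

theorem mem_hullZ {S : Finset (Fin 2 → ℤ)} {p : Fin 2 → ℤ} (hp : p ∈ S) : toR p ∈ hullZ S :=
  subset_convexHull _ _ ⟨p, hp, rfl⟩

theorem detZ {S : Finset (Fin 2 → ℤ)} {V : ℤ} (hV : 2 * area (hullZ S) ≤ V) {p q r s : Fin 2 → ℤ}
    (hp : p ∈ S) (hq : q ∈ S) (hr : r ∈ S) (hs : s ∈ S) :
    |(q 0 - p 0) * (s 1 - r 1) - (s 0 - r 0) * (q 1 - p 1)| ≤ V := by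
  have := (det_le (convex_convexHull ℝ _) (hullZ_finite S) (mem_hullZ hp) (mem_hullZ hq)
    (mem_hullZ hr) (mem_hullZ hs)).trans hV
  simp only [toR] at this
  exact_mod_cast this

theorem ls_le {P : Set (Fin 2 → ℝ)} {S : Finset (Fin 2 → ℤ)}
    (h : LatticeEquivalent P (hullZ S)) (l : ℤ) (hl : 0 ≤ l)
    (hS : ∀ p ∈ S, 0 ≤ p 0 ∧ 0 ≤ p 1 ∧ p 0 + p 1 ≤ l) : lsDelta P ≤ l := by
  obtain ⟨φ, hφ, he⟩ := h
  apply csInf_le ⟨0, fun x hx => hx.1⟩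
  refine ⟨by exact_mod_cast hl, φ, hφ, ?_⟩
  rw [← he]
  apply convexHull_min _ (convex_simplex _)
  rintro _ ⟨p, hp, rfl⟩
  obtain ⟨h0, h1, h2⟩ := hS p hp
  refine ⟨?_, ?_, ?_⟩ <;> simp only [toR] <;> exact_mod_cast (by assumption)

theorem area_line {S : Finset (Fin 2 → ℤ)} (c : ℤ) (h : ∀ p ∈ S, p 0 = c) : area (hullZ S) = 0 := by
  have : hullZ S ⊆ {x | x 0 = (c : ℝ)} := by
    apply convexHull_min
    · rintro _ ⟨p, hp, rfl⟩
      simp [toR, h p hp]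
    · intro x hx y hy s t _ _ hst
      simp only [mem_ofPred_eq] at hx hy ⊢
      simp [hx, hy]
      rw [← add_mul, hst, one_mul]
  rw [area, measure_mono_null this (volume_hyp 0 c)]
  simp

/-- box condition -/
def Box (S : Finset (Fin 2 → ℤ)) (a b : ℕ) : Prop :=
  ∀ p ∈ S, ∀ q ∈ S, q 0 - p 0 ≤ a ∧ q 1 - p 1 ≤ b

theorem exists_box (S : Finset (Fin 2 → ℤ)) : ∃ a b : ℕ, Box S a b := by
  refine ⟨∑ p ∈ S, (p 0).natAbs + ∑ p ∈ S, (p 0).natAbs,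
    ∑ p ∈ S, (p 1).natAbs + ∑ p ∈ S, (p 1).natAbs, ?_⟩
  intro p hp q hq
  have h : ∀ i : Fin 2, ∀ p ∈ S, (p i).natAbs ≤ ∑ p ∈ S, (p i).natAbs := by
    intro i p hp
    exact Finset.single_le_sum (f := fun p : Fin 2 → ℤ => (p i).natAbs) (fun _ _ => Nat.zero_le _) hp
  have h1 := h 0 p hp
  have h2 := h 0 q hq
  have h3 := h 1 p hp
  have h4 := h 1 q hq
  constructor <;> rw [Nat.cast_add] <;> omega

theorem reduce {P : Set (Fin 2 → ℝ)} (S : Finset (Fin 2 → ℤ)) (hP : P = hullZ S)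
    (hA : area P ≠ 0) : ∃ (S' : Finset (Fin 2 → ℤ)) (a b : ℤ), LatticeEquivalent P (hullZ S') ∧
      1 ≤ a ∧ a ≤ b ∧ (∀ p ∈ S', 0 ≤ p 0 ∧ p 0 ≤ a ∧ 0 ≤ p 1 ∧ p 1 ≤ b) ∧
      (∃ p ∈ S', ∃ q ∈ S', q 0 - p 0 = a) ∧
      (∃ p ∈ S', ∃ q ∈ S', q 1 - p 1 = b ∧ 0 ≤ q 0 - p 0) ∧
      (∃ p ∈ S', ∃ q ∈ S', b ≤ (q 0 - p 0) - (q 1 - p 1)) := by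
  classical
  have hex : ∃ n : ℕ, ∃ S' : Finset (Fin 2 → ℤ), ∃ a b : ℕ, LatticeEquivalent P (hullZ S') ∧
      Box S' a b ∧ a + b = n := by
    obtain ⟨a, b, h⟩ := exists_box S
    exact ⟨a + b, S, a, b, hP ▸ equiv_refl _, h, rfl⟩
  obtain ⟨S0, a0, b0, he0, hB0, hn⟩ := Nat.find_spec hex
  have hmin : ∀ (S' : Finset (Fin 2 → ℤ)) (a b : ℕ), LatticeEquivalent P (hullZ S') →
      Box S' a b → a0 + b0 ≤ a + b := by
    intro S' a b h1 h2
    rw [hn]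
    exact Nat.find_min' hex ⟨S', a, b, h1, h2, rfl⟩
  obtain ⟨S1, a, b, he1, hB1, hab, hs⟩ : ∃ (S1 : Finset (Fin 2 → ℤ)) (a b : ℕ),
      LatticeEquivalent P (hullZ S1) ∧ Box S1 a b ∧ a ≤ b ∧ a + b = a0 + b0 := by
    rcases le_total a0 b0 with h | h
    · exact ⟨S0, a0, b0, he0, hB0, h, rfl⟩
    · refine ⟨_, b0, a0, equiv_mv he0 0 1 1 0 0 0 (by norm_num), ?_, h, add_comm _ _⟩
      intro p hp q hq
      rw [Finset.mem_image] at hp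
      obtain ⟨p, hp, rfl⟩ := hp
      rw [Finset.mem_image] at hq
      obtain ⟨q, hq, rfl⟩ := hq
      have := hB0 p hp q hq
      simpa [mv] using this.symm
  rw [← hs] at hmin
  clear hs hn hex hB0 he0
  have hne : ∀ S' : Finset (Fin 2 → ℤ), LatticeEquivalent P (hullZ S') → S'.Nonempty := by
    intro S' h
    rw [Finset.nonempty_iff_ne_empty]
    rintro rfl
    apply hA
    rw [← area_equiv h]
    exact area_line 0 (by simp)
  have ha : 1 ≤ a := by
    by_contra hcon
    obtain ⟨p, hp⟩ := hne _ he1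
    apply hA
    rw [← area_equiv he1]
    refine area_line (p 0) ?_
    intro q hq
    have h1 := (hB1 p hp q hq).1
    have h2 := (hB1 q hq p hp).1
    omega
  have touchx : ∀ S' : Finset (Fin 2 → ℤ), LatticeEquivalent P (hullZ S') → Box S' a b →
      ∃ p ∈ S', ∃ q ∈ S', q 0 - p 0 = a := by
    intro S' h1 h2
    by_contra! hcon
    have := hmin S' (a - 1) b h1 (by
      intro p hp q hq
      have := h2 p hp q hq
      have := hcon p hp q hq
      omega)
    omega
  have touchy : ∀ S' : Finset (Fin 2 → ℤ), LatticeEquivalent P (hullZ S') → Box S' a b →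
      ∃ p ∈ S', ∃ q ∈ S', q 1 - p 1 = b := by
    intro S' h1 h2
    by_contra! hcon
    have := hmin S' a (b - 1) h1 (by
      intro p hp q hq
      have := h2 p hp q hq
      have := hcon p hp q hq
      omega)
    omega
  obtain ⟨S2, he2, hB2, d2⟩ : ∃ (S2 : Finset (Fin 2 → ℤ)),
      LatticeEquivalent P (hullZ S2) ∧ Box S2 a b ∧
      (∃ p ∈ S2, ∃ q ∈ S2, q 1 - p 1 = b ∧ 0 ≤ q 0 - p 0) := by
    obtain ⟨p, hp, q, hq, h⟩ := touchy S1 he1 hB1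
    by_cases hc : 0 ≤ q 0 - p 0
    · exact ⟨S1, he1, hB1, p, hp, q, hq, h, hc⟩
    · refine ⟨_, equiv_mv he1 (-1) 0 0 1 0 0 (by norm_num), ?_, _,
        Finset.mem_image_of_mem _ hp, _, Finset.mem_image_of_mem _ hq, ?_, ?_⟩
      · intro p hp q hq
        rw [Finset.mem_image] at hp
        obtain ⟨p, hp, rfl⟩ := hp
        rw [Finset.mem_image] at hq
        obtain ⟨q, hq, rfl⟩ := hq
        have h1 := hB1 p hp q hq
        have h2 := hB1 q hq p hp
        simp [mv]
        omega
      · simpa [mv] using h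
      · simp [mv]; omega
  obtain ⟨px, hpx, qx, hqx, hx⟩ := touchx S2 he2 hB2
  obtain ⟨py, hpy, qy, hqy, hy, hy'⟩ := d2
  have he3 := equiv_mv he2 1 0 0 1 (- px 0) (- py 1) (by norm_num)
  refine ⟨_, a, b, he3, by exact_mod_cast ha, by exact_mod_cast hab, ?_, ?_, ?_, ?_⟩
  · intro p hp
    rw [Finset.mem_image] at hp
    obtain ⟨p, hp, rfl⟩ := hp
    have h1 := hB2 p hp qx hqx
    have h2 := hB2 px hpx p hp
    have h3 := hB2 p hp qy hqy
    have h4 := hB2 py hpy p hp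
    simp [mv]
    omega
  · refine ⟨_, Finset.mem_image_of_mem _ hpx, _, Finset.mem_image_of_mem _ hqx, ?_⟩
    simp [mv]; omega
  · refine ⟨_, Finset.mem_image_of_mem _ hpy, _, Finset.mem_image_of_mem _ hqy, ?_⟩
    simp [mv]; omega
  · by_contra! hcon
    have he4 := equiv_mv he3 1 0 1 (-1) 0 0 (by norm_num)
    have := hmin _ a (b - 1) he4 (by
      intro p hp q hq
      rw [Finset.mem_image] at hp
      obtain ⟨p, hp, rfl⟩ := hp
      rw [Finset.mem_image] at hq
      obtain ⟨q, hq, rfl⟩ := hq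
      have h0 := hcon p hp q hq
      rw [Finset.mem_image] at hp
      obtain ⟨p, hp, rfl⟩ := hp
      rw [Finset.mem_image] at hq
      obtain ⟨q, hq, rfl⟩ := hq
      have h1 := hB2 p hp q hq
      simp [mv] at h0 ⊢
      omega)
    omega

theorem numeric {a b x y m n : ℤ} (ha : 2 ≤ a) (hab : a ≤ b) (hy0 : 0 ≤ y) (hya : y ≤ a)
    (hma : m ≤ a) (hn : -b ≤ n) (hmn : b ≤ m - n) (h1 : a * b - x * y ≤ a + b - 1)
    (h2 : x * m - a * n ≤ a + b - 1) (h3 : b * m - y * n ≤ a + b - 1) :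
    a = 2 ∧ b = 2 ∧ x = 1 ∧ y = 1 ∧ m = 1 ∧ n = -1 := by
  have hN : (a - 1) * (a - 1) ≤ (a - 1) * (b - 1) := by
    apply mul_le_mul_of_nonneg_left <;> omega
  have hc : 0 < (a - 1) * (a - 1) := by
    apply mul_pos <;> omega
  have hX : (a - 1) * (a - 1) ≤ x * y := by nlinarith
  have hy : 0 < y := by
    rcases hy0.eq_or_lt with h | h
    · subst h; linarith
    · exact h
  have hx : 0 < x := by
    by_contra h
    have : x * y ≤ 0 := mul_nonpos_of_nonpos_of_nonneg (by omega) hy0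
    linarith
  have hm0 : 0 ≤ m := by omega
  have hY : (a - 1) * (b - 1) ≤ (a - x) * m := by
    have : a * (b - m) ≤ a * (-n) := by
      apply mul_le_mul_of_nonneg_left <;> omega
    nlinarith
  have hm : 0 < m := by
    rcases hm0.eq_or_lt with h | h
    · subst h; linarith
    · exact h
  have hxa : 0 < a - x := by
    by_contra h
    have : (a - x) * m ≤ 0 := mul_nonpos_of_nonpos_of_nonneg (by omega) hm0
    linarith
  have h3' : b * m + y * (b - m) ≤ a + b - 1 := by
    have : y * (b - m) ≤ y * (-n) := by
      apply mul_le_mul_of_nonneg_left <;> omega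
    linarith
  have hZ : (a - 1) * (a - 1) ≤ (a - y) * (a - m) := by
    have : a * (m + y - 1) ≤ b * (m + y - 1) := by
      apply mul_le_mul_of_nonneg_right <;> omega
    nlinarith
  have hlt : a < 3 := by
    by_contra! h
    set c := (a - 1) * (a - 1) with hcd
    have hYc : c ≤ (a - x) * m := hN.trans hY
    have q : ∀ z : ℤ, z * (a - z) < c := by
      intro z
      nlinarith [sq_nonneg (2 * z - a)]
    have p1 : c * c ≤ (x * y) * ((a - x) * m) := mul_le_mul hX hYc hc.le (by positivity)
    have p2 : (c * c) * c ≤ ((x * y) * ((a - x) * m)) * ((a - y) * (a - m)) :=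
      mul_le_mul p1 hZ hc.le (by positivity)
    have r1 : (x * (a - x)) * (y * (a - y)) ≤ c * c :=
      mul_le_mul (q x).le (q y).le (mul_nonneg hy0 (by omega)) hc.le
    have r2 : ((x * (a - x)) * (y * (a - y))) * (m * (a - m)) ≤ (c * c) * (m * (a - m)) :=
      mul_le_mul_of_nonneg_right r1 (mul_nonneg hm0 (by omega))
    have r3 : (c * c) * (m * (a - m)) < (c * c) * c :=
      mul_lt_mul_of_pos_left (q m) (by positivity)
    nlinarith
  have ha2 : a = 2 := by omega
  subst ha2
  have hx1 : x = 1 := by omega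
  subst hx1
  have hb : b - 1 ≤ m := by linarith
  have : y < 2 := by
    by_contra h
    have : y = 2 := by omega
    subst this
    linarith
  have : m < 2 := by
    by_contra h
    have : m = 2 := by omega
    subst this
    linarith
  have hy1 : y = 1 := by omega
  have hm1 : m = 1 := by omega
  subst hy1 hm1
  omega

theorem hullZ_eq {S T : Finset (Fin 2 → ℤ)} (h : ∀ p ∈ T, p ∈ S) (k : ∀ p ∈ S, toR p ∈ hullZ T) :
    hullZ S = hullZ T := by
  apply Set.Subset.antisymm
  · apply convexHull_min _ (convex_convexHull ℝ _)
    rintro _ ⟨p, hp, rfl⟩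
    exact k p hp
  · apply convexHull_mono
    exact Set.image_mono h

theorem vec_eq {p : Fin 2 → ℤ} {x y : ℤ} (hx : p 0 = x) (hy : p 1 = y) : p = ![x, y] := by
  ext i
  fin_cases i <;> simp [hx, hy]

theorem hullZ_three (a b c d e f : ℤ) : hullZ {![a, b], ![c, d], ![e, f]} =
    convexHull ℝ {(![(a : ℝ), (b : ℝ)] : Fin 2 → ℝ), ![(c : ℝ), (d : ℝ)], ![(e : ℝ), (f : ℝ)]} := by
  have h : ∀ x y : ℤ, toR ![x, y] = ![(x : ℝ), (y : ℝ)] := by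
    intro x y
    ext i
    fin_cases i <;> simp [toR]
  simp only [hullZ, Finset.coe_insert, Finset.coe_singleton, Set.image_insert_eq,
    Set.image_singleton, h]

theorem caseA {P : Set (Fin 2 → ℝ)} {S : Finset (Fin 2 → ℤ)} {b : ℤ}
    (hE : LatticeEquivalent P (hullZ S)) (hb : 1 ≤ b) (hV : 2 * area P ≤ b)
    (hS : ∀ p ∈ S, 0 ≤ p 0 ∧ p 0 ≤ 1 ∧ 0 ≤ p 1 ∧ p 1 ≤ b) {p q r : Fin 2 → ℤ}
    (hp : p ∈ S) (hq : q ∈ S) (hr : r ∈ S) (hp0 : p 0 = 0) (hq0 : q 0 = 0) (hr0 : r 0 = 1)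
    (hpq : q 1 - p 1 = b) :
    LatticeEquivalent P (convexHull ℝ {(![0, 0] : Fin 2 → ℝ), ![(b : ℝ), 0], ![0, 1]}) := by
  have hV' := hV
  rw [← area_equiv hE] at hV'
  have hp1 : p 1 = 0 := by have := hS p hp; have := hS q hq; omega
  have hq1 : q 1 = b := by omega
  obtain ⟨c, hc⟩ : ∃ c, r 1 = c := ⟨_, rfl⟩
  have ep := vec_eq hp0 hp1
  have eq' := vec_eq hq0 hq1
  have er := vec_eq hr0 hc
  subst ep eq' er
  have hbR : (0 : ℝ) < b := by exact_mod_cast hb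
  have hT : hullZ S = hullZ {![0, 0], ![0, b], ![1, c]} := by
    apply hullZ_eq
    · intro x hx
      simp only [Finset.mem_insert, Finset.mem_singleton] at hx
      rcases hx with rfl | rfl | rfl <;> assumption
    · intro s hs
      obtain ⟨s0, s1, s2, s3⟩ := hS s hs
      have hcase : s 0 = 0 ∨ s 0 = 1 := by omega
      rcases hcase with h | h
      · have e : toR s = (1 - (s 1 : ℝ) / b) • toR ![0, 0] + ((s 1 : ℝ) / b) • toR ![0, b] := by
          ext i
          fin_cases i
          · simp [toR, h]
          · simp [toR]
            field_simp
        rw [e]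
        have hs3 : (s 1 : ℝ) ≤ b := by exact_mod_cast s3
        have hs2 : (0 : ℝ) ≤ s 1 := by exact_mod_cast s2
        apply convex_convexHull ℝ _ (mem_hullZ (by simp)) (mem_hullZ (by simp))
        · rw [sub_nonneg, div_le_one hbR]; exact hs3
        · positivity
        · ring
      · have h1 := abs_le.1 (detZ hV' hp hs hq hr)
        have h2 := abs_le.1 (detZ hV' hp hr hq hs)
        simp [h] at h1 h2
        have hsc : s 1 = c := by omega
        rw [vec_eq h hsc]
        exact mem_hullZ (by simp)
  rw [hT] at hE
  have := equiv_mv hE (-c) 1 1 0 0 0 (by norm_num)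
  rw [show Finset.image (mv (-c) 1 1 0 0 0) {![0, 0], ![0, b], ![1, c]} =
    {![0, 0], ![b, 0], ![0, 1]} by simp [Finset.image_insert, mv], hullZ_three] at this
  simpa using this

theorem caseA' {P : Set (Fin 2 → ℝ)} {S : Finset (Fin 2 → ℤ)} {b : ℤ}
    (hE : LatticeEquivalent P (hullZ S)) (hb : 1 ≤ b) (hV : 2 * area P ≤ b)
    (hS : ∀ p ∈ S, 0 ≤ p 0 ∧ p 0 ≤ 1 ∧ 0 ≤ p 1 ∧ p 1 ≤ b) {p q r : Fin 2 → ℤ}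
    (hp : p ∈ S) (hq : q ∈ S) (hr : r ∈ S) (hqp : q 0 = p 0) (hr0 : r 0 ≠ p 0)
    (hpq : q 1 - p 1 = b) :
    LatticeEquivalent P (convexHull ℝ {(![0, 0] : Fin 2 → ℝ), ![(b : ℝ), 0], ![0, 1]}) := by
  have h1 := hS p hp
  have h2 := hS r hr
  rcases (by omega : p 0 = 0 ∨ p 0 = 1) with h | h
  · exact caseA hE hb hV hS hp hq hr h (by omega) (by omega) hpq
  · refine caseA (equiv_mv hE (-1) 0 0 1 1 0 (by norm_num)) hb hV ?_ (Finset.mem_image_of_mem _ hp)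
      (Finset.mem_image_of_mem _ hq) (Finset.mem_image_of_mem _ hr) ?_ ?_ ?_ ?_
    · intro p hp
      rw [Finset.mem_image] at hp
      obtain ⟨p, hp, rfl⟩ := hp
      have := hS p hp
      simp [mv]
      omega
    all_goals simp [mv]; omega

theorem caseB {S : Finset (Fin 2 → ℤ)}
    (hS : ∀ p ∈ S, 0 ≤ p 0 ∧ p 0 ≤ 1 ∧ 0 ≤ p 1 ∧ p 1 ≤ 1)
    (h00 : ![0, 0] ∈ S) (h01 : ![0, 1] ∈ S) (h10 : ![1, 0] ∈ S) (h11 : ![1, 1] ∈ S) :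
    hullZ S = squareDilate 1 := by
  apply Set.Subset.antisymm
  · apply convexHull_min
    · rintro _ ⟨p, hp, rfl⟩
      obtain ⟨h0, h1, h2, h3⟩ := hS p hp
      intro i
      fin_cases i <;> constructor <;> simp only [toR] <;> exact_mod_cast (by assumption)
    · have : squareDilate 1 = Set.Icc (0 : Fin 2 → ℝ) 1 := by
        ext x
        simp only [squareDilate, mem_ofPred_eq, Set.mem_Icc, Pi.le_def, Pi.zero_apply, Pi.one_apply]
        exact forall_and
      rw [this]
      exact convex_Icc _ _
  · intro x hx
    obtain ⟨a0, a1⟩ := hx 0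
    obtain ⟨b0, b1⟩ := hx 1
    have hc : Convex ℝ (hullZ S) := convex_convexHull ℝ _
    have e0 := hc (mem_hullZ h00) (mem_hullZ h01) (sub_nonneg.2 b1) b0 (by ring)
    have e1 := hc (mem_hullZ h10) (mem_hullZ h11) (sub_nonneg.2 b1) b0 (by ring)
    have e := hc e0 e1 (sub_nonneg.2 a1) a0 (by ring)
    convert e using 1
    ext i
    fin_cases i <;> simp [toR] <;> ring

theorem caseC {P : Set (Fin 2 → ℝ)} {S : Finset (Fin 2 → ℤ)}
    (hE : LatticeEquivalent P (hullZ S)) (hV : 2 * area P ≤ (3 : ℤ))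
    (hS : ∀ p ∈ S, 0 ≤ p 0 ∧ p 0 ≤ 2 ∧ 0 ≤ p 1 ∧ p 1 ≤ 2)
    (hp : ![0, 0] ∈ S) (hq : ![1, 2] ∈ S) (hr : ![2, 1] ∈ S) :
    LatticeEquivalent P (convexHull ℝ {(![0, 0] : Fin 2 → ℝ), ![1, 2], ![2, 1]}) := by
  have hV' := hV
  rw [← area_equiv hE] at hV'
  have hT : hullZ S = hullZ {![0, 0], ![1, 2], ![2, 1]} := by
    apply hullZ_eq
    · intro x hx
      simp only [Finset.mem_insert, Finset.mem_singleton] at hx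
      rcases hx with rfl | rfl | rfl <;> assumption
    · intro s hs
      obtain ⟨s0, s1, s2, s3⟩ := hS s hs
      have h1 := abs_le.1 (detZ hV' hp hs hq hr)
      have h2 := abs_le.1 (detZ hV' hq hs hp hr)
      have h3 := abs_le.1 (detZ hV' hr hs hp hq)
      simp at h1 h2 h3
      have : (s 0 = 0 ∧ s 1 = 0) ∨ (s 0 = 1 ∧ s 1 = 2) ∨ (s 0 = 2 ∧ s 1 = 1) ∨
        (s 0 = 1 ∧ s 1 = 1) := by omega
      rcases this with ⟨h, k⟩ | ⟨h, k⟩ | ⟨h, k⟩ | ⟨h, k⟩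
      · rw [vec_eq h k]
        exact mem_hullZ (by simp)
      · rw [vec_eq h k]
        exact mem_hullZ (by simp)
      · rw [vec_eq h k]
        exact mem_hullZ (by simp)
      · have hc : Convex ℝ (hullZ {![0, 0], ![1, 2], ![2, 1]}) := convex_convexHull ℝ _
        have e1 := hc (mem_hullZ (p := ![1, 2]) (by simp)) (mem_hullZ (p := ![2, 1]) (by simp))
          (by norm_num : (0 : ℝ) ≤ 1 / 2) (by norm_num : (0 : ℝ) ≤ 1 / 2) (by norm_num)
        have e2 := hc (mem_hullZ (p := ![0, 0]) (by simp)) e1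
          (by norm_num : (0 : ℝ) ≤ 1 / 3) (by norm_num : (0 : ℝ) ≤ 2 / 3) (by norm_num)
        convert e2 using 1
        ext i
        fin_cases i <;> simp [toR, h, k] <;> norm_num
  rw [hT, hullZ_three] at hE
  simpa using hE

theorem forward {P : Set (Fin 2 → ℝ)} (S : Finset (Fin 2 → ℤ)) (hP : P = hullZ S)
    (hA : area P ≠ 0) (hls : area P = lsDelta P / 2) :
    (∃ n : ℤ, 1 ≤ n ∧ LatticeEquivalent P
            (convexHull ℝ {(![0, 0] : Fin 2 → ℝ), ![(n : ℝ), 0], ![0, 1]})) ∨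
       LatticeEquivalent P (squareDilate 1) ∨
       LatticeEquivalent P (convexHull ℝ {(![0, 0] : Fin 2 → ℝ), ![1, 2], ![2, 1]}) := by
  obtain ⟨S', a, b, hE, ha, hab, hS, ⟨p1, hp1, q1, hq1, h1⟩, ⟨p2, hp2, q2, hq2, h2, h2'⟩,
    ⟨p3, hp3, q3, hq3, h3⟩⟩ := reduce S hP hA
  clear hP S
  by_cases hV : 2 * area P ≤ ((a + b - 1 : ℤ) : ℝ)
  · have hV' := hV
    rw [← area_equiv hE] at hV'
    have B1 := hS p1 hp1
    have B1' := hS q1 hq1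
    have B2 := hS p2 hp2
    have B2' := hS q2 hq2
    have B3 := hS p3 hp3
    have B3' := hS q3 hq3
    rcases (by omega : a = 1 ∨ 2 ≤ a) with ha1 | ha2
    · left
      refine ⟨b, by omega, ?_⟩
      subst ha1
      have hV2 : 2 * area P ≤ (b : ℝ) := by simpa using hV
      rw [add_sub_cancel_left] at hV'
      have other : ∀ p : Fin 2 → ℤ, ∃ r ∈ S', r 0 ≠ p 0 := by
        intro p
        by_cases h : p1 0 = p 0
        · exact ⟨q1, hq1, by omega⟩
        · exact ⟨p1, hp1, h⟩
      have fin : ∀ p ∈ S', ∀ q ∈ S', q 0 = p 0 → q 1 - p 1 = b → LatticeEquivalent P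
            (convexHull ℝ {(![0, 0] : Fin 2 → ℝ), ![(b : ℝ), 0], ![0, 1]}) := by
        intro p hp q hq h k
        obtain ⟨r, hr, hr'⟩ := other p
        exact caseA' hE (by omega) hV2 hS hp hq hr h hr' k
      rcases (by omega : q2 0 = p2 0 ∨ (p2 0 = 0 ∧ q2 0 = 1)) with h | ⟨h, h'⟩
      · exact fin p2 hp2 q2 hq2 h h2
      · have D := abs_le.1 (detZ hV' hp2 hq2 hp3 hq3)
        rw [h, h', h2] at D
        rcases (by omega : q3 0 = p3 0 ∨ (p3 0 = 0 ∧ q3 0 = 1)) with k | ⟨k, k'⟩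
        · exact fin q3 hq3 p3 hp3 k.symm (by omega)
        · rw [k, k'] at D
          have hb1 : b = 1 := by omega
          have e : q3 1 = p3 1 := by omega
          rcases (by omega : p3 1 = 0 ∨ p3 1 = 1) with j | j
          · exact fin q3 hq3 q2 hq2 (by omega) (by omega)
          · exact fin p2 hp2 p3 hp3 (by omega) (by omega)
    · right; right
      have D1 := abs_le.1 (detZ hV' hp1 hq1 hp2 hq2)
      have D2 := abs_le.1 (detZ hV' hp1 hq1 hp3 hq3)
      have D3 := abs_le.1 (detZ hV' hp2 hq2 hp3 hq3)
      obtain ⟨x, hx⟩ : ∃ x, q1 1 - p1 1 = x := ⟨_, rfl⟩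
      obtain ⟨y, hy⟩ : ∃ y, q2 0 - p2 0 = y := ⟨_, rfl⟩
      obtain ⟨m, hm⟩ : ∃ m, q3 0 - p3 0 = m := ⟨_, rfl⟩
      obtain ⟨n, hn⟩ : ∃ n, q3 1 - p3 1 = n := ⟨_, rfl⟩
      rw [h1, h2, hx, hy] at D1
      rw [h1, hx, hm, hn] at D2
      rw [h2, hy, hm, hn] at D3
      obtain ⟨rfl, rfl, rfl, rfl, rfl, rfl⟩ := numeric (x := x) (y := y) (m := m) (n := n) ha2 hab
        (by omega) (by omega) (by omega) (by omega) (by omega) (by linarith [D1.2])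
        (by linarith [D2.1]) (by linarith [D3.1])
      have nodiag : ∀ u ∈ S', ∀ v ∈ S', u = ![0, 0] → v = ![2, 2] → False := by
        rintro u hu v hv rfl rfl
        have D := abs_le.1 (detZ hV' hu hv hp3 hq3)
        rw [hm, hn] at D
        simp at D
      rcases (by omega : p1 1 = 0 ∨ p1 1 = 1) with i | i <;>
      rcases (by omega : p2 0 = 0 ∨ p2 0 = 1) with j | j
      · refine caseC hE (by simpa using hV) hS ?_ ?_ ?_
        · rwa [vec_eq (by omega : p1 0 = 0) i] at hp1
        · rwa [vec_eq (by omega : q2 0 = 1) (by omega : q2 1 = 2)] at hq2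
        · rwa [vec_eq (by omega : q1 0 = 2) (by omega : q1 1 = 1)] at hq1
      · exact (nodiag p1 hp1 q2 hq2 (vec_eq (by omega) (by omega)) (vec_eq (by omega) (by omega))).elim
      · exact (nodiag p2 hp2 q1 hq1 (vec_eq (by omega) (by omega)) (vec_eq (by omega) (by omega))).elim
      · refine caseC (equiv_mv hE (-1) 0 0 (-1) 2 2 (by norm_num)) (by simpa using hV) ?_ ?_ ?_ ?_
        · intro p hp
          rw [Finset.mem_image] at hp
          obtain ⟨p, hp, rfl⟩ := hp
          have := hS p hp
          simp [mv]
          omega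
        · rw [Finset.mem_image]
          exact ⟨q1, hq1, vec_eq (by simp [mv]; omega) (by simp [mv]; omega)⟩
        · rw [Finset.mem_image]
          exact ⟨p2, hp2, vec_eq (by simp [mv]; omega) (by simp [mv]; omega)⟩
        · rw [Finset.mem_image]
          exact ⟨p1, hp1, vec_eq (by simp [mv]; omega) (by simp [mv]; omega)⟩
  · right; left
    have hbig : ¬ lsDelta P ≤ ((a + b - 1 : ℤ) : ℝ) := by
      intro h
      apply hV
      linarith
    have hle : lsDelta P ≤ ((a + b : ℤ) : ℝ) := by
      apply ls_le hE _ (by omega)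
      intro p hp
      have := hS p hp
      omega
    have hV' : 2 * area (hullZ S') ≤ ((a + b : ℤ) : ℝ) := by
      rw [area_equiv hE]
      linarith
    have c11 : ![a, b] ∈ S' := by
      by_contra hc
      apply hbig
      apply ls_le hE _ (by omega)
      intro p hp
      have := hS p hp
      have : ¬ (p 0 = a ∧ p 1 = b) := fun h => hc (vec_eq h.1 h.2 ▸ hp)
      omega
    have c01 : ![0, b] ∈ S' := by
      by_contra hc
      apply hbig
      apply ls_le (equiv_mv hE (-1) 0 0 1 a 0 (by norm_num)) _ (by omega)
      intro p hp
      rw [Finset.mem_image] at hp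
      obtain ⟨p, hp, rfl⟩ := hp
      have := hS p hp
      have : ¬ (p 0 = 0 ∧ p 1 = b) := fun h => hc (vec_eq h.1 h.2 ▸ hp)
      simp [mv]
      omega
    have c10 : ![a, 0] ∈ S' := by
      by_contra hc
      apply hbig
      apply ls_le (equiv_mv hE 1 0 0 (-1) 0 b (by norm_num)) _ (by omega)
      intro p hp
      rw [Finset.mem_image] at hp
      obtain ⟨p, hp, rfl⟩ := hp
      have := hS p hp
      have : ¬ (p 0 = a ∧ p 1 = 0) := fun h => hc (vec_eq h.1 h.2 ▸ hp)
      simp [mv]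
      omega
    have c00 : ![0, 0] ∈ S' := by
      by_contra hc
      apply hbig
      apply ls_le (equiv_mv hE (-1) 0 0 (-1) a b (by norm_num)) _ (by omega)
      intro p hp
      rw [Finset.mem_image] at hp
      obtain ⟨p, hp, rfl⟩ := hp
      have := hS p hp
      have : ¬ (p 0 = 0 ∧ p 1 = 0) := fun h => hc (vec_eq h.1 h.2 ▸ hp)
      simp [mv]
      omega
    have D := (abs_le.1 (detZ hV' c00 c11 c01 c10)).1
    simp at D
    have hb1 : b = 1 := by nlinarith
    have ha1 : a = 1 := by omega
    subst hb1 ha1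
    rw [← caseB hS c00 c01 c10 c11]
    exact hE

/-- A convex lattice polygon `P` of nonzero area satisfies `A(P) = ls_Δ(P)/2` iff `P`
is lattice-equivalent to `conv{(0,0),(l,0),(0,1)}` with `l = ls_Δ(P)` a positive integer,
or to the unit square (with `ls_Δ(P) = 2`), or to `conv{(0,0),(1,2),(2,1)}`
(with `ls_Δ(P) = 3`). -/
theorem stmt8 (P : Set (Fin 2 → ℝ)) (hP : IsLatticePolygon P) (hA : area P ≠ 0) :
    area P = lsDelta P / 2 ↔
      ((∃ n : ℤ, 1 ≤ n ∧ lsDelta P = (n : ℝ) ∧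
          LatticeEquivalent P
            (convexHull ℝ {(![0, 0] : Fin 2 → ℝ), ![(n : ℝ), 0], ![0, 1]})) ∨
       (LatticeEquivalent P (squareDilate 1) ∧ lsDelta P = 2) ∨
       (LatticeEquivalent P
          (convexHull ℝ {(![0, 0] : Fin 2 → ℝ), ![1, 2], ![2, 1]}) ∧ lsDelta P = 3)) := by
  have areaA : ∀ n : ℤ, 1 ≤ n → LatticeEquivalent P
      (convexHull ℝ {(![0, 0] : Fin 2 → ℝ), ![(n : ℝ), 0], ![0, 1]}) → area P = n / 2 := by
    intro n hn h
    have hn' : (0 : ℝ) ≤ n := by exact_mod_cast (by omega : 0 ≤ n)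
    rw [← area_equiv h, volume_tri]
    simp [abs_of_nonneg hn']
  have areaB : LatticeEquivalent P (squareDilate 1) → area P = 1 := by
    intro h
    rw [← area_equiv h, area, volume_square]
    simp
  have areaC : LatticeEquivalent P
      (convexHull ℝ {(![0, 0] : Fin 2 → ℝ), ![1, 2], ![2, 1]}) → area P = 3 / 2 := by
    intro h
    rw [← area_equiv h, volume_tri]
    norm_num
  constructor
  · intro h
    obtain ⟨S, -, hS⟩ := hP
    rcases forward S hS hA h with ⟨n, hn, k⟩ | k | k
    · have := areaA n hn k
      exact Or.inl ⟨n, hn, by linarith, k⟩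
    · have := areaB k
      exact Or.inr (Or.inl ⟨k, by linarith⟩)
    · have := areaC k
      exact Or.inr (Or.inr ⟨k, by linarith⟩)
  · rintro (⟨n, hn, hl, k⟩ | ⟨k, hl⟩ | ⟨k, hl⟩)
    · rw [areaA n hn k, hl]
    · rw [areaB k, hl]; norm_num
    · rw [areaC k, hl]
end

section
/- Let P ⊂ ℝ² be a convex lattice polygon of nonzero area A(P), and let h = ls_□(P). Then A(P) ≥ h/2. -/
open Set MeasureTheory Pointwise

lemma volT : ENNReal.ofReal (1/2) ≤ volume (simplexDilate 1) := by
  have hm : volume ((fun x : Fin 2 → ℝ => (fun _ => (1:ℝ)) - x) ⁻¹' (simplexDilate 1))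
      = volume (simplexDilate 1) :=
    (volume.measurePreserving_sub_left (fun _ => (1:ℝ))).measure_preimage_equiv
      (f := MeasurableEquiv.subLeft (fun _ => (1:ℝ))) _
  have hsub : Set.Icc (0 : Fin 2 → ℝ) 1 ⊆ simplexDilate 1 ∪
      ((fun x : Fin 2 → ℝ => (fun _ => (1:ℝ)) - x) ⁻¹' (simplexDilate 1)) := by
    intro x hx
    have h0 := hx.1 0
    have h1 := hx.1 1
    have h2 := hx.2 0
    have h3 := hx.2 1
    simp only [Pi.zero_apply, Pi.one_apply] at h0 h1 h2 h3
    by_cases h : x 0 + x 1 ≤ 1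
    · left
      exact ⟨h0, h1, h⟩
    · right
      refine ⟨?_, ?_, ?_⟩ <;> simp only [Pi.sub_apply] <;> linarith
  have hv : volume (Set.Icc (0 : Fin 2 → ℝ) 1) = 1 := by
    rw [Real.volume_Icc_pi]; simp
  have h1 : (1 : ENNReal) ≤ volume (simplexDilate 1) + volume (simplexDilate 1) := by
    calc (1 : ENNReal) = volume (Set.Icc (0 : Fin 2 → ℝ) 1) := hv.symm
      _ ≤ _ := measure_mono hsub
      _ ≤ _ := measure_union_le _ _
      _ = _ := by rw [hm]
  rw [← two_mul] at h1
  have : ENNReal.ofReal (1/2) = 2⁻¹ := by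
    rw [one_div, ENNReal.ofReal_inv_of_pos (by norm_num)]; simp
  rw [this]
  by_contra hlt
  push Not at hlt
  have h2 : 2 * volume (simplexDilate 1) < 2 * 2⁻¹ :=
    (ENNReal.mul_lt_mul_iff_right (by norm_num) (by norm_num)).2 hlt
  rw [ENNReal.mul_inv_cancel (by norm_num) (by norm_num)] at h2
  exact absurd h1 (not_le.2 h2)

/-- Area lower bound for a triangle. -/
lemma volTri (a b c : Fin 2 → ℝ) :
    ENNReal.ofReal (|(b 0 - a 0) * (c 1 - a 1) - (c 0 - a 0) * (b 1 - a 1)| / 2)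
      ≤ volume (convexHull ℝ {a, b, c}) := by
  let M : Matrix (Fin 2) (Fin 2) ℝ := !![b 0 - a 0, c 0 - a 0; b 1 - a 1, c 1 - a 1]
  have hsub : (fun x => a + x) '' ((Matrix.toLin' M) '' (simplexDilate 1)) ⊆
      convexHull ℝ {a, b, c} := by
    rintro _ ⟨_, ⟨x, hx, rfl⟩, rfl⟩
    obtain ⟨h0, h1, h2⟩ := hx
    have ha : a ∈ convexHull ℝ {a, b, c} := subset_convexHull _ _ (by simp)
    have hb : b ∈ convexHull ℝ {a, b, c} := subset_convexHull _ _ (by simp)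
    have hc : c ∈ convexHull ℝ {a, b, c} := subset_convexHull _ _ (by simp)
    have key := (convex_convexHull ℝ {a, b, c}).sum_mem (t := Finset.univ)
      (w := ![1 - x 0 - x 1, x 0, x 1]) (z := ![a, b, c])
      (by intro i _; fin_cases i <;> simp <;> linarith)
      (by simp [Fin.sum_univ_three]; try ring)
      (by intro i _; fin_cases i <;> simp [ha, hb, hc])
    convert key using 1
    ext i
    fin_cases i <;>
    simp [M, Fin.sum_univ_three, Matrix.mulVec, dotProduct, Fin.sum_univ_two] <;> ring
  refine le_trans ?_ (measure_mono hsub)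
  rw [Set.image_add_left, measure_preimage_add, Measure.addHaar_image_linearMap,
    LinearMap.det_toLin', Matrix.det_fin_two]
  refine le_trans ?_ (mul_le_mul_right volT _)
  rw [← ENNReal.ofReal_mul (abs_nonneg _)]
  apply ENNReal.ofReal_le_ofReal
  simp [M]
  linarith

lemma areaChord (P : Set (Fin 2 → ℝ)) (hP : Convex ℝ P) (X Y L R : Fin 2 → ℝ)
    (hX : X ∈ P) (hY : Y ∈ P) (hL : L ∈ P) (hR : R ∈ P) (hXY : X 0 = Y 0)
    (h1 : L 0 ≤ X 0) (h2 : X 0 ≤ R 0) (hc : 0 ≤ Y 1 - X 1) :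
    ENNReal.ofReal ((Y 1 - X 1) * (R 0 - L 0) / 2) ≤ volume P := by
  have hlin : IsLinearMap ℝ (fun p : Fin 2 → ℝ => p 0) := ⟨fun _ _ => rfl, fun _ _ => rfl⟩
  have s1 : convexHull ℝ {X, Y, L} ⊆ {p | p 0 ≤ X 0} := by
    apply convexHull_min
    · rintro p (rfl | rfl | rfl)
      · exact le_refl (p 0)
      · exact hXY.ge
      · exact h1
    · exact convex_halfSpace_le hlin _
  have s2 : convexHull ℝ {X, Y, R} ⊆ {p | X 0 ≤ p 0} := by
    apply convexHull_min
    · rintro p (rfl | rfl | rfl)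
      · exact le_refl (p 0)
      · exact hXY.le
      · exact h2
    · exact convex_halfSpace_ge hlin _
  have m1 : convexHull ℝ {X, Y, L} ⊆ P := by
    apply convexHull_min _ hP
    rintro p (rfl | rfl | rfl) <;> assumption
  have m2 : convexHull ℝ {X, Y, R} ⊆ P := by
    apply convexHull_min _ hP
    rintro p (rfl | rfl | rfl) <;> assumption
  have hae : AEDisjoint volume (convexHull ℝ {X, Y, L}) (convexHull ℝ {X, Y, R}) := by
    refine measure_mono_null (t := {p | p 0 = X 0}) ?_ ?_
    · intro p hp
      exact le_antisymm (s1 hp.1) (s2 hp.2)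
    · rw [volume_pi]
      exact Measure.pi_hyperplane _ _ _
  have hms : NullMeasurableSet (convexHull ℝ {X, Y, R}) volume := by
    have : IsCompact (convexHull ℝ {X, Y, R}) :=
      (Set.Finite.isCompact_convexHull ℝ (Set.toFinite _))
    exact this.measurableSet.nullMeasurableSet
  have hu := measure_union₀ hms hae
  have hle : volume (convexHull ℝ {X, Y, L}) + volume (convexHull ℝ {X, Y, R}) ≤ volume P := by
    rw [← hu]
    exact measure_mono (Set.union_subset m1 m2)
  refine le_trans ?_ hle
  refine le_trans ?_ (add_le_add (volTri X Y L) (volTri X Y R))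
  rw [← ENNReal.ofReal_add (by positivity) (by positivity)]
  apply ENNReal.ofReal_le_ofReal
  have e1 : (Y 0 - X 0) * (L 1 - X 1) - (L 0 - X 0) * (Y 1 - X 1)
    = (X 0 - L 0) * (Y 1 - X 1) := by rw [hXY]; ring
  have e2 : (Y 0 - X 0) * (R 1 - X 1) - (R 0 - X 0) * (Y 1 - X 1)
    = -((R 0 - X 0) * (Y 1 - X 1)) := by rw [hXY]; ring
  rw [e1, e2, abs_neg, abs_of_nonneg (mul_nonneg (by linarith) hc),
    abs_of_nonneg (mul_nonneg (by linarith) hc)]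
  nlinarith

/-- cast of an integer point. -/
def castPt (p : Fin 2 → ℤ) : Fin 2 → ℝ := fun i => (p i : ℝ)

lemma chordExists (P : Set (Fin 2 → ℝ)) (hP : Convex ℝ P) (S : Finset (Fin 2 → ℤ))
    (hS : ∀ p ∈ S, castPt p ∈ P) (w1 w2 : ℤ) (hw1 : 1 ≤ w1) (hw : w1 ≤ w2)
    (hx : ∀ p ∈ S, ∀ q ∈ S, p 0 - q 0 ≤ w1) (hy : ∀ p ∈ S, ∀ q ∈ S, p 1 - q 1 ≤ w2)
    (e : ℤ) (he : e = 1 ∨ e = -1)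
    (p q r s : Fin 2 → ℤ) (hp : p ∈ S) (hq : q ∈ S) (hr : r ∈ S) (hs : s ∈ S)
    (h0 : p 1 - q 1 = w2) (hd : 0 ≤ e * (p 0 - q 0))
    (h1 : w2 ≤ (r 1 - s 1) - e * (r 0 - s 0)) :
    ∃ X ∈ P, ∃ Y ∈ P, X 0 = Y 0 ∧ 0 ≤ Y 1 - X 1 ∧ (w2 : ℝ) ≤ (Y 1 - X 1) * w1 := by
  have hfull : ∀ p ∈ S, ∀ q ∈ S, p 0 = q 0 → w2 ≤ p 1 - q 1 →
      ∃ X ∈ P, ∃ Y ∈ P, X 0 = Y 0 ∧ 0 ≤ Y 1 - X 1 ∧ (w2 : ℝ) ≤ (Y 1 - X 1) * w1 := by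
    intro p hp q hq h h'
    have h'' : (w2 : ℝ) ≤ p 1 - q 1 := by exact_mod_cast h'
    have hw1' : (1 : ℝ) ≤ w1 := by exact_mod_cast hw1
    have hw2' : (1 : ℝ) ≤ w2 := by exact_mod_cast hw1.trans hw
    refine ⟨castPt q, hS q hq, castPt p, hS p hp, by simp [castPt, h], ?_, ?_⟩
    · simp only [castPt]; linarith
    · simp only [castPt]; nlinarith
  have hrs := hy r hr s hs
  have x1 := hx p hp q hq
  have x2 := hx q hq p hp
  have x3 := hx r hr s hs
  have x4 := hx s hs r hr
  have x5 := hx p hp r hr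
  have x6 := hx r hr p hp
  have x7 := hx q hq s hs
  have x8 := hx s hs q hq
  by_cases hd0 : p 0 = q 0
  · exact hfull p hp q hq hd0 h0.ge
  by_cases ha0 : r 0 = s 0
  · refine hfull r hr s hs ha0 ?_
    rw [ha0] at h1; simpa using h1
  by_cases hw11 : w1 = 1
  · subst hw11
    have c1 : r 0 = q 0 := by rcases he with rfl | rfl <;> omega
    have c2 : p 0 = s 0 := by rcases he with rfl | rfl <;> omega
    by_cases hh : w2 ≤ r 1 - q 1
    · exact hfull r hr q hq c1 hh
    · exact hfull p hp s hs c2 (by rcases he with rfl | rfl <;> omega)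
  · have hw2 : 2 ≤ w1 := by omega
    obtain ⟨d, hdd⟩ : ∃ d, d = e * (p 0 - q 0) := ⟨_, rfl⟩
    obtain ⟨a, haa⟩ : ∃ a, a = -e * (r 0 - s 0) := ⟨_, rfl⟩
    have d1 : 0 < d := by rcases he with rfl | rfl <;> omega
    have d2 : d ≤ w1 := by rcases he with rfl | rfl <;> omega
    have a1 : 0 < a := by rcases he with rfl | rfl <;> omega
    have a2 : a ≤ w1 := by rcases he with rfl | rfl <;> omega
    have b1 : w2 - a ≤ r 1 - s 1 := by rw [haa]; linarith
    have D : a * (p 0 - q 0) + d * (r 0 - s 0) = 0 := by rw [haa, hdd]; ring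
    have D' : (a : ℝ) * (p 0 - q 0) + d * (r 0 - s 0) = 0 := by exact_mod_cast D
    have d1' : (0 : ℝ) < d := by exact_mod_cast d1
    have a1' : (0 : ℝ) < a := by exact_mod_cast a1
    have d2' : (d : ℝ) ≤ w1 := by exact_mod_cast d2
    have a2' : (a : ℝ) ≤ w1 := by exact_mod_cast a2
    have b1' : (w2 : ℝ) - a ≤ r 1 - s 1 := by exact_mod_cast b1
    have h0' : (p 1 : ℝ) - q 1 = w2 := by exact_mod_cast h0
    have hw2' : (2 : ℝ) ≤ w1 := by exact_mod_cast hw2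
    have hw' : (w1 : ℝ) ≤ w2 := by exact_mod_cast hw
    have hpos : (0 : ℝ) < a + d := by positivity
    have hsum : (a : ℝ) / (a + d) + d / (a + d) = 1 := by field_simp
    have key : (w2 : ℝ) * (a + d) ≤ (a * (p 1 - q 1) + d * (r 1 - s 1)) * w1 := by
      rw [h0']
      have k1 : (a : ℝ) * w2 + d * (w2 - a) ≤ a * w2 + d * (r 1 - s 1) := by nlinarith
      have k2 : (2 : ℝ) * (a * d) ≤ (a + d) * w1 := by nlinarith [sq_nonneg ((a : ℝ) - d)]
      have k3 : (a + d : ℝ) * w2 ≤ 2 * (a * w2 + d * (w2 - a)) := by nlinarith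
      have k4 : (0 : ℝ) ≤ a * w2 + d * (w2 - a) := by nlinarith
      calc (w2 : ℝ) * (a + d) ≤ (a * w2 + d * (w2 - a)) * 2 := by linarith
        _ ≤ (a * w2 + d * (w2 - a)) * w1 := by gcongr
        _ ≤ _ := by gcongr
    have key2 : (w2 : ℝ) ≤ ((a * (p 1 - q 1) + d * (r 1 - s 1)) / (a + d)) * w1 := by
      rw [div_mul_eq_mul_div, le_div_iff₀ hpos]; exact key
    refine ⟨(a / (a + d) : ℝ) • castPt q + (d / (a + d) : ℝ) • castPt s,
      hP (hS q hq) (hS s hs) (by positivity) (by positivity) hsum,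
      (a / (a + d) : ℝ) • castPt p + (d / (a + d) : ℝ) • castPt r,
      hP (hS p hp) (hS r hr) (by positivity) (by positivity) hsum, ?_, ?_⟩
    · simp only [castPt, Pi.add_apply, Pi.smul_apply, smul_eq_mul]
      field_simp
      linarith
    · have e1 : ((a / (a + d) : ℝ) • castPt p + (d / (a + d) : ℝ) • castPt r) 1 -
        ((a / (a + d) : ℝ) • castPt q + (d / (a + d) : ℝ) • castPt s) 1 =
        (a * (p 1 - q 1) + d * (r 1 - s 1)) / (a + d) := by
        simp only [castPt, Pi.add_apply, Pi.smul_apply, smul_eq_mul]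
        field_simp
        ring
      rw [e1]
      refine ⟨?_, key2⟩
      by_contra hneg
      push Not at hneg
      nlinarith

/-- lattice width of a finite set of points in direction `u`. -/
def wd (S : Finset (Fin 2 → ℤ)) (u : Fin 2 → ℤ) : ℕ :=
  (S ×ˢ S).sup fun x => (u ⬝ᵥ x.1 - u ⬝ᵥ x.2).toNat

lemma wd_le (S : Finset (Fin 2 → ℤ)) (u p q : Fin 2 → ℤ) (hp : p ∈ S) (hq : q ∈ S) :
    u ⬝ᵥ p - u ⬝ᵥ q ≤ wd S u := by
  have : (u ⬝ᵥ p - u ⬝ᵥ q).toNat ≤ wd S u :=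
    Finset.le_sup (f := fun x : (Fin 2 → ℤ) × (Fin 2 → ℤ) => (u ⬝ᵥ x.1 - u ⬝ᵥ x.2).toNat)
      (b := (p, q)) (Finset.mk_mem_product hp hq)
  omega

lemma wd_ex (S : Finset (Fin 2 → ℤ)) (hS : S.Nonempty) (u : Fin 2 → ℤ) :
    ∃ p ∈ S, ∃ q ∈ S, u ⬝ᵥ p - u ⬝ᵥ q = wd S u := by
  obtain ⟨x, hx, h⟩ := Finset.exists_mem_eq_sup (S ×ˢ S) (hS.product hS)
    (fun x => (u ⬝ᵥ x.1 - u ⬝ᵥ x.2).toNat)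
  rw [Finset.mem_product] at hx
  change wd S u = _ at h
  by_cases h0 : 0 ≤ u ⬝ᵥ x.1 - u ⬝ᵥ x.2
  · exact ⟨x.1, hx.1, x.2, hx.2, by omega⟩
  · exact ⟨x.1, hx.1, x.1, hx.1, by omega⟩

lemma minBasis (S : Finset (Fin 2 → ℤ)) : ∃ A : Matrix (Fin 2) (Fin 2) ℤ,
    (A.det = 1 ∨ A.det = -1) ∧ wd S (A 0) ≤ wd S (A 1) ∧ wd S (A 1) ≤ wd S (A 1 - A 0) ∧
    wd S (A 1) ≤ wd S (A 1 + A 0) := by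
  let f : {A : Matrix (Fin 2) (Fin 2) ℤ // A.det = 1 ∨ A.det = -1} → ℕ :=
    fun A => wd S (A.1 0) + wd S (A.1 1)
  have : Nonempty {A : Matrix (Fin 2) (Fin 2) ℤ // A.det = 1 ∨ A.det = -1} :=
    ⟨⟨1, Or.inl Matrix.det_one⟩⟩
  obtain ⟨⟨A, hA⟩, hmin⟩ : ∃ A, ∀ B, f A ≤ f B :=
    ⟨Function.argmin f, fun B => Function.argmin_le f B⟩
  have hmin' : ∀ u v : Fin 2 → ℤ, (u 0 * v 1 - u 1 * v 0 = 1 ∨ u 0 * v 1 - u 1 * v 0 = -1) →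
      wd S (A 0) + wd S (A 1) ≤ wd S u + wd S v := by
    intro u v h
    have := hmin ⟨Matrix.of ![u, v], by simpa [Matrix.det_fin_two] using h⟩
    exact this
  rw [Matrix.det_fin_two] at hA
  rcases le_total (wd S (A 0)) (wd S (A 1)) with h | h
  · refine ⟨A, by rwa [Matrix.det_fin_two], h, ?_, ?_⟩
    · have := hmin' (A 0) (A 1 - A 0) (by
        simp only [Pi.sub_apply]
        rcases hA with hA | hA
        · left; linarith
        · right; linarith)
      omega
    · have := hmin' (A 0) (A 1 + A 0) (by
        simp only [Pi.add_apply]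
        rcases hA with hA | hA
        · left; linarith
        · right; linarith)
      omega
  · refine ⟨Matrix.of ![A 1, A 0], ?_, ?_⟩
    · rw [Matrix.det_fin_two]
      simp
      rcases hA with hA | hA
      · right; linarith
      · left; linarith
    · change wd S (A 1) ≤ wd S (A 0) ∧ wd S (A 0) ≤ wd S (A 0 - A 1) ∧
        wd S (A 0) ≤ wd S (A 0 + A 1)
      refine ⟨h, ?_, ?_⟩
      · have := hmin' (A 0 - A 1) (A 1) (by
          simp only [Pi.sub_apply]
          rcases hA with hA | hA
          · left; linarith
          · right; linarith)
        omega
      · have := hmin' (A 0 + A 1) (A 1) (by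
          simp only [Pi.add_apply]
          rcases hA with hA | hA
          · left; linarith
          · right; linarith)
        omega

/-- A convex lattice polygon `P` of nonzero area satisfies `A(P) ≥ ls_□(P)/2`. -/
theorem stmt9 (P : Set (Fin 2 → ℝ)) (hP : IsLatticePolygon P) (hA : area P ≠ 0) :
    lsSquare P / 2 ≤ area P := by
  obtain ⟨S, hSne, hPS⟩ := hP
  obtain ⟨A, hdet, hw, hm, hp⟩ := minBasis S
  set AR : Matrix (Fin 2) (Fin 2) ℝ := A.map (Int.cast : ℤ → ℝ) with hAR
  -- transformed points
  have hcast : ∀ p : Fin 2 → ℤ, AR.mulVec (castPt p) = castPt (A.mulVec p) := by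
    intro p
    ext i
    simp [AR, castPt, Matrix.mulVec, dotProduct]
  have hdetR : |AR.det| = 1 := by
    have : AR.det = (A.det : ℝ) := by
      simp [AR, Matrix.det_fin_two]
    rw [this]
    rcases hdet with h | h <;> rw [h] <;> simp
  set Q : Set (Fin 2 → ℝ) := (Matrix.toLin' AR) '' P with hQ
  have hvol : volume Q = volume P := by
    rw [hQ, Measure.addHaar_image_linearMap, LinearMap.det_toLin', hdetR]
    simp
  have hPconv : Convex ℝ P := by rw [hPS]; exact convex_convexHull _ _
  have hQconv : Convex ℝ Q := hPconv.linear_image _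
  have hfin : volume P ≠ ⊤ := by
    rw [hPS]
    exact ((Set.Finite.isCompact_convexHull ℝ
      ((Finset.finite_toSet S).image _))).measure_lt_top.ne
  have hSP : ∀ p ∈ S, castPt p ∈ P := by
    intro p hp
    rw [hPS]
    exact subset_convexHull _ _ ⟨p, hp, rfl⟩
  set S' : Finset (Fin 2 → ℤ) := S.image A.mulVec with hS'
  have hS'Q : ∀ p ∈ S', castPt p ∈ Q := by
    intro p hp
    obtain ⟨q, hq, rfl⟩ := Finset.mem_image.1 hp
    exact ⟨castPt q, hSP q hq, by rw [Matrix.toLin'_apply, hcast]⟩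
  have hmem : ∀ p ∈ S, A.mulVec p ∈ S' := fun p hp => Finset.mem_image_of_mem _ hp
  have hx : ∀ p ∈ S', ∀ q ∈ S', p 0 - q 0 ≤ (wd S (A 0) : ℤ) := by
    intro p hp q hq
    obtain ⟨p, hp', rfl⟩ := Finset.mem_image.1 hp
    obtain ⟨q, hq', rfl⟩ := Finset.mem_image.1 hq
    exact wd_le S (A 0) p q hp' hq'
  have hy : ∀ p ∈ S', ∀ q ∈ S', p 1 - q 1 ≤ (wd S (A 1) : ℤ) := by
    intro p hp q hq
    obtain ⟨p, hp', rfl⟩ := Finset.mem_image.1 hp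
    obtain ⟨q, hq', rfl⟩ := Finset.mem_image.1 hq
    exact wd_le S (A 1) p q hp' hq'
  obtain ⟨R, hR, L, hL, hRL⟩ := wd_ex S hSne (A 0)
  obtain ⟨T, hT, B, hB, hTB⟩ := wd_ex S hSne (A 1)
  obtain ⟨r1, hr1, s1, hs1, hrs1⟩ := wd_ex S hSne (A 1 - A 0)
  obtain ⟨r2, hr2, s2, hs2, hrs2⟩ := wd_ex S hSne (A 1 + A 0)
  rw [sub_dotProduct, sub_dotProduct] at hrs1
  rw [add_dotProduct, add_dotProduct] at hrs2
  set w1 := wd S (A 0) with hw1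
  set w2 := wd S (A 1) with hw2
  -- bounding box of Q
  have hbox : ∀ x ∈ Q, ((A.mulVec L 0 : ℤ) : ℝ) ≤ x 0 ∧ x 0 ≤ ((A.mulVec R 0 : ℤ) : ℝ) ∧
      ((A.mulVec B 1 : ℤ) : ℝ) ≤ x 1 ∧ x 1 ≤ ((A.mulVec T 1 : ℤ) : ℝ) := by
    have hconv : Convex ℝ {x : Fin 2 → ℝ | ((A.mulVec L 0 : ℤ) : ℝ) ≤ x 0 ∧
      x 0 ≤ ((A.mulVec R 0 : ℤ) : ℝ) ∧
      ((A.mulVec B 1 : ℤ) : ℝ) ≤ x 1 ∧ x 1 ≤ ((A.mulVec T 1 : ℤ) : ℝ)} := by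
      have l0 : IsLinearMap ℝ (fun p : Fin 2 → ℝ => p 0) := ⟨fun _ _ => rfl, fun _ _ => rfl⟩
      have l1 : IsLinearMap ℝ (fun p : Fin 2 → ℝ => p 1) := ⟨fun _ _ => rfl, fun _ _ => rfl⟩
      exact (convex_halfSpace_ge l0 _).inter ((convex_halfSpace_le l0 _).inter
        ((convex_halfSpace_ge l1 _).inter (convex_halfSpace_le l1 _)))
    have hsub : Q ⊆ {x : Fin 2 → ℝ | ((A.mulVec L 0 : ℤ) : ℝ) ≤ x 0 ∧
      x 0 ≤ ((A.mulVec R 0 : ℤ) : ℝ) ∧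
      ((A.mulVec B 1 : ℤ) : ℝ) ≤ x 1 ∧ x 1 ≤ ((A.mulVec T 1 : ℤ) : ℝ)} := by
      rw [hQ, hPS, LinearMap.image_convexHull]
      refine convexHull_min ?_ hconv
      rintro _ ⟨_, ⟨p, hp, rfl⟩, rfl⟩
      have : (Matrix.toLin' AR) (fun i => (p i : ℝ)) = castPt (A.mulVec p) := by
        rw [Matrix.toLin'_apply]; exact hcast p
      rw [this]
      simp only [castPt, Set.mem_setOf_eq, Int.cast_le]
      have hp' := hmem p hp
      have q1 := hx _ (hmem R hR) _ hp'
      have q2 := hx _ hp' _ (hmem L hL)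
      have q3 := hy _ (hmem T hT) _ hp'
      have q4 := hy _ hp' _ (hmem B hB)
      change A.mulVec R 0 - A.mulVec L 0 = _ at hRL
      change A.mulVec T 1 - A.mulVec B 1 = _ at hTB
      refine ⟨by linarith, by linarith, by linarith, by linarith⟩
    exact hsub
  change A.mulVec R 0 - A.mulVec L 0 = _ at hRL
  change A.mulVec T 1 - A.mulVec B 1 = _ at hTB
  have hRL' : ((A.mulVec R 0 : ℤ) : ℝ) - ((A.mulVec L 0 : ℤ) : ℝ) = (w1 : ℝ) := by
    exact_mod_cast hRL
  have hTB' : ((A.mulVec T 1 : ℤ) : ℝ) - ((A.mulVec B 1 : ℤ) : ℝ) = (w2 : ℝ) := by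
    exact_mod_cast hTB
  have hwR : (w1 : ℝ) ≤ w2 := by exact_mod_cast hw
  -- positivity of the width
  have hpos : 1 ≤ w1 := by
    by_contra h0
    have h0' : w1 = 0 := by omega
    rw [h0'] at hRL'
    apply hA
    have : volume Q = 0 := by
      refine measure_mono_null (t := {p | p 0 = ((A.mulVec L 0 : ℤ) : ℝ)}) ?_ ?_
      · intro x hx
        have := hbox x hx
        have h3 : ((0 : ℕ) : ℝ) = 0 := Nat.cast_zero
        exact le_antisymm (by linarith [this.2.1]) this.1
      · rw [volume_pi]
        exact Measure.pi_hyperplane _ _ _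
    rw [area, ← hvol, this]; rfl
  -- lattice size bound
  have hls : lsSquare P ≤ w2 := by
    apply csInf_le
    · exact ⟨0, fun l hl => hl.1⟩
    · refine ⟨by positivity, fun x => AR.mulVec x + fun i => ((![-A.mulVec L 0, -A.mulVec B 1] i : ℤ) : ℝ),
        ⟨A, ![-A.mulVec L 0, -A.mulVec B 1], hdet, fun x => rfl⟩, ?_⟩
      rintro _ ⟨x, hx, rfl⟩
      obtain ⟨b1, b2, b3, b4⟩ := hbox (AR.mulVec x) ⟨x, hx, by rw [Matrix.toLin'_apply]⟩
      intro i
      fin_cases i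
      · simp only [Fin.zero_eta, Pi.add_apply, Matrix.cons_val_zero, Int.cast_neg, Set.mem_Icc]
        constructor <;> linarith
      · simp only [Fin.mk_one, Pi.add_apply, Matrix.cons_val_one, Matrix.cons_val_zero, Int.cast_neg, Set.mem_Icc]
        constructor <;> linarith
  -- chord
  have hch : ∃ X ∈ Q, ∃ Y ∈ Q, X 0 = Y 0 ∧ 0 ≤ Y 1 - X 1 ∧
      (((w2 : ℕ) : ℤ) : ℝ) ≤ (Y 1 - X 1) * (((w1 : ℕ) : ℤ) : ℝ) := by
    rcases le_total 0 (A.mulVec T 0 - A.mulVec B 0) with h | h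
    · refine chordExists Q hQconv S' hS'Q w1 w2 (by exact_mod_cast hpos) (by exact_mod_cast hw)
        hx hy 1 (Or.inl rfl) _ _ _ _ (hmem T hT) (hmem B hB) (hmem r1 hr1) (hmem s1 hs1) hTB
        (by linarith) ?_
      change (w2 : ℤ) ≤ A 1 ⬝ᵥ r1 - A 1 ⬝ᵥ s1 - 1 * (A 0 ⬝ᵥ r1 - A 0 ⬝ᵥ s1)
      have : (w2 : ℤ) ≤ wd S (A 1 - A 0) := by exact_mod_cast hm
      linarith
    · refine chordExists Q hQconv S' hS'Q w1 w2 (by exact_mod_cast hpos) (by exact_mod_cast hw)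
        hx hy (-1) (Or.inr rfl) _ _ _ _ (hmem T hT) (hmem B hB) (hmem r2 hr2) (hmem s2 hs2) hTB
        (by linarith) ?_
      change (w2 : ℤ) ≤ A 1 ⬝ᵥ r2 - A 1 ⬝ᵥ s2 - (-1) * (A 0 ⬝ᵥ r2 - A 0 ⬝ᵥ s2)
      have : (w2 : ℤ) ≤ wd S (A 1 + A 0) := by exact_mod_cast hp
      linarith
  obtain ⟨X, hX, Y, hY, hXY, hc, hcw⟩ := hch
  have harea := areaChord Q hQconv X Y (castPt (A.mulVec L)) (castPt (A.mulVec R)) hX hY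
    (hS'Q _ (hmem L hL)) (hS'Q _ (hmem R hR)) hXY (hbox X hX).1 (hbox X hX).2.1 hc
  rw [hvol, ENNReal.ofReal_le_iff_le_toReal hfin] at harea
  change (Y 1 - X 1) * (((A.mulVec R 0 : ℤ) : ℝ) - ((A.mulVec L 0 : ℤ) : ℝ)) / 2 ≤ area P at harea
  rw [hRL'] at harea
  simp only [Int.cast_natCast] at hcw
  linarith
end
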